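/- Let z be a minimiser of Problem (P) for the data (z0, v0, zf, vf, t_f), with maximum curvature a. Then there exist 0 = s0 ≤ s1 ≤ s2 ≤ s3 = t_f and constants ω1, ω2, ω3 ∈ {−a, 0, a} such that z̈(t) = ω_i·J(ż(t)) for a.e. t ∈ (s_{i−1}, s_i), i = 1, 2, 3; that is, z is a concatenation of at most three pieces, each of which is a line segment or a circular arc of curvature exactly a. Moreover the partition can be chosen so that if ω1 = ω3 = 0 with s1 > 0 and s3 > s2, and ω2 ≠ 0, then a·(s2 − s1) = 2π (in a path of type SOS the middle arc is a full circle). (Any solution is of type CXC with X ∈ {S, C, O}, or SOS, or a sub-path thereof, with all circular arcs of the same radius 1/a.) -/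

import Mathlib

open Set MeasureTheory Real

noncomputable section

/-- Points of the Euclidean plane. -/
abbrev Pt : Type := EuclideanSpace ℝ (Fin 2)

/-- The point of the plane with coordinates `(x, y)`. -/
def pt (x y : ℝ) : Pt := (WithLp.equiv 2 (Fin 2 → ℝ)).symm ![x, y]

/-- Rotation of the plane by `π/2`. -/
def J (v : Pt) : Pt := pt (-(v 1)) (v 0)

/-- `z`, with derivative `z'`, is an admissible curve on `[t1, t2]` for the oriented
endpoint data `(p0, u0)`, `(p1, u1)`: it is differentiable with Lipschitz (hence
continuous) derivative `z'`, has unit speed, and matches the endpoint data. -/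
def AdmissibleOn (t1 t2 : ℝ) (p0 u0 p1 u1 : Pt) (z z' : ℝ → Pt) : Prop :=
  (∀ t ∈ Icc t1 t2, HasDerivWithinAt z (z' t) (Icc t1 t2) t) ∧
  (∃ K : NNReal, LipschitzOnWith K z' (Icc t1 t2)) ∧
  (∀ t ∈ Icc t1 t2, ‖z' t‖ = 1) ∧
  z t1 = p0 ∧ z t2 = p1 ∧ z' t1 = u0 ∧ z' t2 = u1

/-- The maximum curvature of a unit-speed curve with derivative `z'` on the set `s`:
the least Lipschitz constant of `z'` on `s` (equivalently, the essential supremum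
of the norm of the second derivative). -/
def maxCurvOn (s : Set ℝ) (z' : ℝ → Pt) : ℝ :=
  sInf {a : ℝ | 0 ≤ a ∧ LipschitzOnWith (Real.toNNReal a) z' s}

/-- The piece `[s1, s2]` of the unit-speed curve with derivative `z'` is a circular
arc of signed curvature `ω`: `z'' = ω • J z'` a.e. there. -/
def IsArcOn (z' : ℝ → Pt) (ω s1 s2 : ℝ) : Prop :=
  ∀ᵐ t ∂volume, t ∈ Ioo s1 s2 → HasDerivAt z' (ω • J (z' t)) t

/-- The piece `[s1, s2]` of the unit-speed curve with derivative `z'` is a straight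
line segment: `z'` is constant there. -/
def IsLineOn (z' : ℝ → Pt) (s1 s2 : ℝ) : Prop :=
  ∀ s ∈ Icc s1 s2, ∀ t ∈ Icc s1 s2, z' s = z' t

/-- The piece `[s1, s2]` is a full circular loop of curvature `a`: a circular arc of
signed curvature `±a` whose turning angle is a positive integer multiple of `2π`. -/
def IsFullLoopOn (z' : ℝ → Pt) (a s1 s2 : ℝ) : Prop :=
  ∃ ω : ℝ, |ω| = a ∧ IsArcOn z' ω s1 s2 ∧ ∃ k : ℕ, 0 < k ∧ a * (s2 - s1) = 2 * π * k


theorem ift_pos {ι F : Type*} [Fintype ι] [NormedAddCommGroup F] [NormedSpace ℝ F]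
    [FiniteDimensional ℝ F] (f : (ι → ℝ) → F) (f' : (ι → ℝ) →L[ℝ] F)
    (hf : HasStrictFDerivAt f f' 0) (hsurj : f'.range = ⊤) (x : ι → ℝ) (hx : f' x = 0)
    (hpos : ∀ i, 0 < x i) (ε : ℝ) (hε : 0 < ε) :
    ∃ y : ι → ℝ, (∀ i, 0 < y i ∧ y i < ε) ∧ f y = f 0 := by
  have hd := hf.to_implicitFunction hsurj
  set φ := hf.implicitFunction f f' hsurj (f 0) with hφ
  have h0 : φ 0 = 0 := hf.implicitFunction_apply_image hsurj
  let v : f'.ker := ⟨x, hx⟩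
  have hline : HasDerivAt (fun τ : ℝ => φ (τ • v)) x 0 := by
    have h1 : HasDerivAt (fun τ : ℝ => τ • v) v 0 := by
      simpa using (hasDerivAt_id (0:ℝ)).smul_const v
    have h2 : HasFDerivAt φ (f'.ker.subtypeL) ((0:ℝ) • v) := by
      rw [zero_smul]; exact hd.hasFDerivAt
    have := h2.comp_hasDerivAt (0:ℝ) h1
    exact this
  have hcoord : ∀ i, HasDerivAt (fun τ : ℝ => φ (τ • v) i) (x i) 0 := by
    intro i
    exact (hasDerivAt_pi.1 hline) i
  have hev1 : ∀ i, ∀ᶠ τ in nhdsWithin (0:ℝ) (Ioi 0), 0 < φ (τ • v) i := by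
    intro i
    have h := (hcoord i).tendsto_slope
    have h' : Filter.Tendsto (slope (fun τ : ℝ => φ (τ • v) i) 0) (nhdsWithin 0 (Ioi 0)) (nhds (x i)) :=
      h.mono_left (nhdsWithin_mono _ (fun y hy => ne_of_gt hy))
    filter_upwards [h'.eventually (lt_mem_nhds (hpos i)), self_mem_nhdsWithin] with τ h1 h2
    have h2 : 0 < τ := h2
    rw [slope_def_field] at h1
    simp only [zero_smul, h0, Pi.zero_apply, sub_zero] at h1
    exact (div_pos_iff_of_pos_right h2).1 h1
  have hev2 : ∀ i, ∀ᶠ τ in nhdsWithin (0:ℝ) (Ioi 0), φ (τ • v) i < ε := by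
    intro i
    have h := (hcoord i).continuousAt.tendsto
    simp only [zero_smul, h0, Pi.zero_apply] at h
    exact nhdsWithin_le_nhds (h.eventually (gt_mem_nhds hε))
  have hev3 : ∀ᶠ τ in nhdsWithin (0:ℝ) (Ioi 0), f (φ (τ • v)) = f 0 := by
    have h := hf.map_implicitFunction_eq hsurj
    have ht : Filter.Tendsto (fun τ : ℝ => ((f 0, τ • v) : F × f'.ker)) (nhds 0) (nhds (f 0, 0)) := by
      have hc : Continuous (fun τ : ℝ => ((f 0, τ • v) : F × f'.ker)) := by fun_prop
      have := hc.tendsto 0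
      simpa using this
    exact nhdsWithin_le_nhds (ht.eventually h)
  have hall := ((Filter.eventually_all.2 hev1).and (Filter.eventually_all.2 hev2)).and hev3
  obtain ⟨τ, ⟨h1, h2⟩, h3⟩ := hall.exists
  exact ⟨φ (τ • v), fun i => ⟨h1 i, h2 i⟩, h3⟩

theorem exists_support {F : Type*} [NormedAddCommGroup F] [NormedSpace ℝ F]
    [FiniteDimensional ℝ F] (K : Set F) (hK : Convex ℝ K) (h0 : (0 : F) ∈ K)
    (hnint : (0 : F) ∉ interior K) : ∃ f : F →L[ℝ] ℝ, f ≠ 0 ∧ ∀ k ∈ K, f k ≤ 0 := by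
  by_cases hne : (interior K).Nonempty
  · obtain ⟨f, hf, h⟩ := geometric_hahn_banach_of_nonempty_interior_point hK hnint hne
    exact ⟨f, hf, fun k hk => by simpa using h k hk⟩
  · rw [hK.interior_nonempty_iff_affineSpan_eq_top] at hne
    have hs : Submodule.span ℝ K ≠ ⊤ := by
      intro hs
      apply hne
      have hins := affineSpan_insert_zero (k := ℝ) K
      rw [Set.insert_eq_of_mem h0, hs] at hins
      rw [← SetLike.coe_set_eq, hins]
      simp
    obtain ⟨f, hf, h⟩ := Submodule.exists_le_ker_of_lt_top _ (lt_top_iff_ne_top.2 hs)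
    refine ⟨f.toContinuousLinearMap, ?_, ?_⟩
    · intro h; apply hf
      ext x
      have := congrArg (fun g : F →L[ℝ] ℝ => g x) h
      simpa using this
    · intro k hk
      have : f k = 0 := h (Submodule.subset_span hk)
      simp [this]

def Lip (a : ℝ) (θ : ℝ → ℝ) : Prop := ∀ x y, |θ x - θ y| ≤ a * |x - y|

theorem Lip.continuous {a : ℝ} {θ : ℝ → ℝ} (h : Lip a θ) : Continuous θ := by
  have : LipschitzWith (Real.toNNReal a) θ := by
    apply LipschitzWith.of_dist_le_mul
    intro x y
    rw [Real.dist_eq, Real.dist_eq]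
    refine (h x y).trans ?_
    gcongr
    exact Real.le_coe_toNNReal a
  exact this.continuous

def Mini (T a : ℝ) (θ : ℝ → ℝ) : Prop :=
  Lip a θ ∧ ∀ b < a, ∀ ψ : ℝ → ℝ, Lip b ψ → ψ 0 = θ 0 →
    (∃ k : ℤ, ψ T = θ T + k * (2 * π)) →
    (∫ t in (0:ℝ)..T, cos (ψ t)) = (∫ t in (0:ℝ)..T, cos (θ t)) →
    (∫ t in (0:ℝ)..T, sin (ψ t)) = (∫ t in (0:ℝ)..T, sin (θ t)) → False

theorem strict_of_quad {E F : Type*} [NormedAddCommGroup E] [NormedSpace ℝ E]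
    [NormedAddCommGroup F] [NormedSpace ℝ F] (f : E → F) (f' : E →L[ℝ] F) (C : ℝ)
    (h : ∀ x y, ‖f x - f y - f' (x - y)‖ ≤ C * (‖x‖ + ‖y‖) * ‖x - y‖) :
    HasStrictFDerivAt f f' 0 := by
  rw [hasStrictFDerivAt_iff_isLittleO]
  rw [Asymptotics.isLittleO_iff]
  intro c hc
  have ht : Filter.Tendsto (fun p : E × E => C * (‖p.1‖ + ‖p.2‖)) (nhds (0, 0)) (nhds 0) := by
    have hc : Continuous (fun p : E × E => C * (‖p.1‖ + ‖p.2‖)) := by fun_prop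
    simpa using hc.tendsto (0, 0)
  filter_upwards [ht.eventually (gt_mem_nhds hc)] with p hp
  refine (h p.1 p.2).trans ?_
  gcongr

theorem quad_bound (φ φ' : ℝ → ℝ) (hφ : ∀ x, HasDerivAt φ (φ' x) x)
    (hφ' : ∀ x y, |φ' x - φ' y| ≤ |x - y|) (A s r : ℝ) :
    |φ (A + s) - φ (A + r) - φ' A * (s - r)| ≤ (|s| + |r|) * |s - r| := by
  have hd : ∀ u ∈ uIcc r s, HasDerivWithinAt (fun u => φ (A + u) - φ' A * u)
      (φ' (A + u) - φ' A) (uIcc r s) u := by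
    intro u _
    have h1 : HasDerivAt (fun u => φ (A + u)) (φ' (A + u)) u := by
      simpa using (hφ (A + u)).comp_const_add A u
    have h2 : HasDerivAt (fun u => φ' A * u) (φ' A) u := by
      simpa using (hasDerivAt_id u).const_mul (φ' A)
    exact (h1.sub h2).hasDerivWithinAt
  have hb : ∀ u ∈ uIcc r s, ‖φ' (A + u) - φ' A‖ ≤ |s| + |r| := by
    intro u hu
    rw [Real.norm_eq_abs]
    refine (hφ' _ _).trans ?_
    rw [add_sub_cancel_left]
    rcases mem_uIcc.1 hu with h | h
    · rw [abs_le]; constructor <;> cases abs_cases s <;> cases abs_cases r <;> linarith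
    · rw [abs_le]; constructor <;> cases abs_cases s <;> cases abs_cases r <;> linarith
  have := (convex_uIcc r s).norm_image_sub_le_of_norm_hasDerivWithin_le hd hb
    left_mem_uIcc right_mem_uIcc
  rw [Real.norm_eq_abs, Real.norm_eq_abs] at this
  convert this using 2
  ring

theorem quad_int (φ φ' : ℝ → ℝ) (hφ : ∀ x, HasDerivAt φ (φ' x) x)
    (hφ' : ∀ x y, |φ' x - φ' y| ≤ |x - y|) (T M : ℝ) (hT : 0 ≤ T) (θ p q : ℝ → ℝ)
    (hθ : Continuous θ) (hp : Continuous p) (hq : Continuous q) (P Q R : ℝ)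
    (hP : ∀ t ∈ Icc 0 T, |p t| ≤ M * P) (hQ : ∀ t ∈ Icc 0 T, |q t| ≤ M * Q)
    (hR : ∀ t ∈ Icc 0 T, |p t - q t| ≤ M * R) :
    |(∫ t in (0:ℝ)..T, φ (θ t + p t)) - (∫ t in (0:ℝ)..T, φ (θ t + q t))
      - ∫ t in (0:ℝ)..T, φ' (θ t) * (p t - q t)| ≤ (M * M * T) * (P + Q) * R := by
  have c1 : Continuous φ := continuous_iff_continuousAt.2 fun x => (hφ x).continuousAt
  have c2 : Continuous φ' := by
    have : LipschitzWith 1 φ' := by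
      apply LipschitzWith.of_dist_le_mul
      intro x y
      simpa [Real.dist_eq] using hφ' x y
    exact this.continuous
  have i1 : IntervalIntegrable (fun t => φ (θ t + p t)) volume 0 T :=
    Continuous.intervalIntegrable (by fun_prop) _ _
  have i2 : IntervalIntegrable (fun t => φ (θ t + q t)) volume 0 T :=
    Continuous.intervalIntegrable (by fun_prop) _ _
  have i3 : IntervalIntegrable (fun t => φ' (θ t) * (p t - q t)) volume 0 T :=
    Continuous.intervalIntegrable (by fun_prop) _ _
  rw [← intervalIntegral.integral_sub i1 i2, ← intervalIntegral.integral_sub (i1.sub i2) i3]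
  have := intervalIntegral.norm_integral_le_of_norm_le_const (a := 0) (b := T)
    (C := M * M * (P + Q) * R)
    (f := fun t => φ (θ t + p t) - φ (θ t + q t) - φ' (θ t) * (p t - q t)) ?_
  · rw [Real.norm_eq_abs, sub_zero, abs_of_nonneg hT] at this
    refine this.trans (le_of_eq ?_)
    ring
  · intro t ht
    rw [uIoc_of_le hT] at ht
    have ht : t ∈ Icc 0 T := ⟨ht.1.le, ht.2⟩
    rw [Real.norm_eq_abs]
    refine (quad_bound φ φ' hφ hφ' _ _ _).trans ?_
    calc (|p t| + |q t|) * |p t - q t| ≤ (M * P + M * Q) * (M * R) := by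
          have := hP t ht
          have := hQ t ht
          have := hR t ht
          gcongr
          have := abs_nonneg (p t)
          have := abs_nonneg (q t)
          linarith
      _ = _ := by ring

theorem sum_bound {ι : Type*} [Fintype ι] (η : ι → ℝ → ℝ) (hη : ∀ i, Continuous (η i)) (T : ℝ) :
    ∃ M : ℝ, 0 ≤ M ∧ ∀ x : ι → ℝ, ∀ t ∈ Icc 0 T, |∑ i, x i * η i t| ≤ M * ‖x‖ := by
  have : ∀ i, ∃ C, ∀ t ∈ Icc 0 T, ‖η i t‖ ≤ C := fun i =>
    (isCompact_Icc).exists_bound_of_continuousOn (hη i).continuousOn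
  choose C hC using this
  refine ⟨∑ i, |C i|, Finset.sum_nonneg fun i _ => abs_nonneg _, ?_⟩
  intro x t ht
  refine (Finset.abs_sum_le_sum_abs _ _).trans ?_
  rw [Finset.sum_mul]
  apply Finset.sum_le_sum
  intro i _
  rw [abs_mul, mul_comm]
  have h1 := hC i t ht
  have h2 := norm_le_pi_norm x i
  rw [Real.norm_eq_abs] at h1 h2
  have := h1.trans (le_abs_self _)
  gcongr

def Lvec (T : ℝ) (θ η : ℝ → ℝ) : ℝ × ℝ × ℝ :=
  (η T, ∫ t in (0:ℝ)..T, -sin (θ t) * η t, ∫ t in (0:ℝ)..T, cos (θ t) * η t)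

theorem lin_int {ι : Type*} [Fintype ι] (η : ι → ℝ → ℝ) (hη : ∀ i, Continuous (η i)) (T : ℝ)
    (g : ℝ → ℝ) (hg : Continuous g) (x : ι → ℝ) :
    (∫ t in (0:ℝ)..T, g t * ∑ i, x i * η i t) = ∑ i, x i * ∫ t in (0:ℝ)..T, g t * η i t := by
  simp_rw [Finset.mul_sum]
  rw [intervalIntegral.integral_finset_sum]
  · congr 1
    ext i
    rw [← intervalIntegral.integral_const_mul]
    congr 1
    ext t
    ring
  · intro i _
    exact Continuous.intervalIntegrable (by have := hη i; fun_prop) _ _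

theorem strictG {ι : Type*} [Fintype ι] (η : ι → ℝ → ℝ) (hη : ∀ i, Continuous (η i)) (T : ℝ)
    (hT : 0 ≤ T) (θ : ℝ → ℝ) (hθ : Continuous θ) :
    HasStrictFDerivAt (fun x : ι → ℝ => ((∑ i, x i * η i T,
      ∫ t in (0:ℝ)..T, cos (θ t + ∑ i, x i * η i t),
      ∫ t in (0:ℝ)..T, sin (θ t + ∑ i, x i * η i t)) : ℝ × ℝ × ℝ))
      (Fintype.linearCombination ℝ (fun i => Lvec T θ (η i))).toContinuousLinearMap 0 := by
  obtain ⟨M, hM0, hM⟩ := sum_bound η hη T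
  apply strict_of_quad _ _ (M * M * T)
  intro x y
  have hcx : ∀ x : ι → ℝ, Continuous (fun t => ∑ i, x i * η i t) := fun x =>
    continuous_finset_sum _ fun i _ => (hη i).const_mul _
  have hdiff : ∀ t, ∑ i, x i * η i t - ∑ i, y i * η i t = ∑ i, (x - y) i * η i t := by
    intro t
    rw [← Finset.sum_sub_distrib]
    congr 1; ext i; simp; ring
  have hR : ∀ t ∈ Icc 0 T, |∑ i, x i * η i t - ∑ i, y i * η i t| ≤ M * ‖x - y‖ := by
    intro t ht
    rw [hdiff]
    exact hM _ t ht
  have e1 := quad_int cos (fun x => -sin x) hasDerivAt_cos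
    (fun x y => by
      have := Real.abs_sin_sub_sin_le y x
      rw [abs_sub_comm x y]; convert this using 2; ring) T M hT θ _ _ hθ
    (hcx x) (hcx y) _ _ _ (hM x) (hM y) hR
  have e2 := quad_int sin cos hasDerivAt_sin
    (fun x y => Real.abs_cos_sub_cos_le x y) T M hT θ _ _ hθ
    (hcx x) (hcx y) _ _ _ (hM x) (hM y) hR
  simp_rw [hdiff] at e1 e2
  rw [lin_int η hη T _ (by fun_prop)] at e1 e2
  have e0 : (0:ℝ) ≤ M * M * T * (‖x‖ + ‖y‖) * ‖x - y‖ := by positivity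
  have hL : (Fintype.linearCombination ℝ (fun i => Lvec T θ (η i))).toContinuousLinearMap (x - y)
      = ((∑ i, (x - y) i * η i T, ∑ i, (x - y) i * ∫ t in (0:ℝ)..T, -sin (θ t) * η i t,
          ∑ i, (x - y) i * ∫ t in (0:ℝ)..T, cos (θ t) * η i t) : ℝ × ℝ × ℝ) := by
    rw [LinearMap.coe_toContinuousLinearMap', Fintype.linearCombination_apply]
    simp only [Lvec, Prod.smul_mk, smul_eq_mul]
    refine Prod.ext ?_ (Prod.ext ?_ ?_)
    · simp [Prod.fst_sum]
    · simp [Prod.fst_sum, Prod.snd_sum]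
    · simp [Prod.snd_sum]
  rw [hL]
  rw [Prod.norm_def, Prod.norm_def]
  refine max_le ?_ (max_le ?_ ?_)
  · have : (∑ i, x i * η i T - ∑ i, y i * η i T) - ∑ i, (x - y) i * η i T = 0 := by
      rw [hdiff, sub_self]
    simp only [Prod.fst_sub, this, norm_zero]
    exact e0
  · exact e1
  · exact e2

theorem Lip.nonneg {a : ℝ} {θ : ℝ → ℝ} (h : Lip a θ) : 0 ≤ a := by
  have := h 0 1
  have h2 := abs_nonneg (θ 0 - θ 1)
  simp at this
  linarith

def Kset (T a : ℝ) (θ : ℝ → ℝ) : Set (ℝ × ℝ × ℝ) :=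
  {v | ∃ ψ : ℝ → ℝ, Lip a ψ ∧ ψ 0 = θ 0 ∧ v = Lvec T θ (fun t => ψ t - θ t)}

theorem Lvec_comb (T : ℝ) (θ η ξ : ℝ → ℝ) (hθ : Continuous θ) (hη : Continuous η)
    (hξ : Continuous ξ) (x y : ℝ) :
    x • Lvec T θ η + y • Lvec T θ ξ = Lvec T θ (fun t => x * η t + y * ξ t) := by
  have key : ∀ g : ℝ → ℝ, Continuous g →
      x * (∫ t in (0:ℝ)..T, g t * η t) + y * (∫ t in (0:ℝ)..T, g t * ξ t) =
      ∫ t in (0:ℝ)..T, g t * (x * η t + y * ξ t) := by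
    intro g hg
    rw [← intervalIntegral.integral_const_mul, ← intervalIntegral.integral_const_mul,
      ← intervalIntegral.integral_add]
    · congr 1; ext t; ring
    · exact Continuous.intervalIntegrable (by fun_prop) _ _
    · exact Continuous.intervalIntegrable (by fun_prop) _ _
  simp only [Lvec, Prod.smul_mk, smul_eq_mul, Prod.mk_add_mk]
  rw [key _ (by fun_prop), key _ (by fun_prop)]

theorem Kset_convex (T a : ℝ) (θ : ℝ → ℝ) (hθ : Continuous θ) : Convex ℝ (Kset T a θ) := by
  rintro _ ⟨ψ, hψ, h0, rfl⟩ _ ⟨χ, hχ, k0, rfl⟩ x y hx hy hxy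
  refine ⟨fun t => x * ψ t + y * χ t, ?_, ?_, ?_⟩
  · intro s t
    have h1 := hψ s t
    have h2 := hχ s t
    calc |x * ψ s + y * χ s - (x * ψ t + y * χ t)| = |x * (ψ s - ψ t) + y * (χ s - χ t)| := by
          congr 1; ring
      _ ≤ x * |ψ s - ψ t| + y * |χ s - χ t| := by
          refine (abs_add_le _ _).trans ?_
          rw [abs_mul, abs_mul, abs_of_nonneg hx, abs_of_nonneg hy]
      _ ≤ x * (a * |s - t|) + y * (a * |s - t|) := by gcongr
      _ = (x + y) * (a * |s - t|) := by ring
      _ = a * |s - t| := by rw [hxy, one_mul]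
  · show x * ψ 0 + y * χ 0 = θ 0
    rw [h0, k0, ← add_mul, hxy, one_mul]
  · have c1 := hψ.continuous
    have c2 := hχ.continuous
    rw [Lvec_comb T θ _ _ hθ (by fun_prop) (by fun_prop)]
    congr 1
    ext t
    have : θ t = (x + y) * θ t := by rw [hxy, one_mul]
    linear_combination this

theorem Kset_not_interior (T a : ℝ) (hT : 0 < T) (ha : 0 < a) (θ : ℝ → ℝ) (hm : Mini T a θ) :
    (0 : ℝ × ℝ × ℝ) ∉ interior (Kset T a θ) := by
  intro hnint
  have hθ : Continuous θ := hm.1.continuous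
  have hsmall : ∀ w : ℝ × ℝ × ℝ, ∀ᶠ ρ in nhdsWithin (0:ℝ) (Ioi 0), ρ • w ∈ Kset T a θ := by
    intro w
    have hc : Continuous (fun ρ : ℝ => ρ • w) := by fun_prop
    have := hc.tendsto 0
    rw [zero_smul] at this
    exact nhdsWithin_le_nhds (this.eventually (mem_interior_iff_mem_nhds.1 hnint))
  let ks : ℝ × ℝ × ℝ := Lvec T θ (fun t => θ 0 - θ t)
  have hall := ((((hsmall (1, 0, 0)).and (hsmall (0, 1, 0))).and (hsmall (0, 0, 1))).and
    (hsmall (-(1, 1, 1) - ks))).and (self_mem_nhdsWithin (a := (0:ℝ)) (s := Ioi 0))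
  obtain ⟨ρ, ⟨⟨⟨⟨ψ1, l1, s1, e1⟩, ⟨ψ2, l2, s2, e2⟩⟩, ⟨ψ3, l3, s3, e3⟩⟩, ⟨ψ4, l4, s4, e4⟩⟩, hρ⟩ :=
    hall.exists
  have hρ : 0 < ρ := hρ
  have c1 := l1.continuous
  have c2 := l2.continuous
  have c3 := l3.continuous
  have c4 := l4.continuous
  let η : Fin 5 → ℝ → ℝ := ![fun t => θ 0 - θ t, fun t => ψ1 t - θ t, fun t => ψ2 t - θ t,
    fun t => ψ3 t - θ t, fun t => ψ4 t - θ t]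
  have hη : ∀ i, Continuous (η i) := by
    intro i
    fin_cases i
    · show Continuous (fun t => θ 0 - θ t); fun_prop
    · show Continuous (fun t => ψ1 t - θ t); fun_prop
    · show Continuous (fun t => ψ2 t - θ t); fun_prop
    · show Continuous (fun t => ψ3 t - θ t); fun_prop
    · show Continuous (fun t => ψ4 t - θ t); fun_prop
  have hs := strictG η hη T hT.le θ hθ
  have happ : ∀ x : Fin 5 → ℝ,
      (Fintype.linearCombination ℝ (fun i => Lvec T θ (η i))).toContinuousLinearMap x =
      x 0 • ks + x 1 • ρ • (1, 0, 0) + x 2 • ρ • (0, 1, 0) + x 3 • ρ • (0, 0, 1) +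
      x 4 • ρ • (-(1, 1, 1) - ks) := by
    intro x
    rw [LinearMap.coe_toContinuousLinearMap', Fintype.linearCombination_apply,
      Fin.sum_univ_five, e1, e2, e3, e4]
    rfl
  obtain ⟨y, hy, hGy⟩ := ift_pos _ _ hs
    (by
      rw [LinearMap.range_eq_top]
      rintro ⟨u, v, w⟩
      refine ⟨![0, u / ρ, v / ρ, w / ρ, 0], ?_⟩
      refine (happ _).trans ?_
      simp
      refine ⟨?_, ?_, ?_⟩ <;> field_simp)
    ![ρ, 1, 1, 1, 1]
    (by
      rw [happ]
      refine Prod.ext ?_ (Prod.ext ?_ ?_) <;> simp <;> ring)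
    (by intro i; fin_cases i <;> simp [hρ])
    (1 / 10) (by norm_num)
  simp only [Prod.mk.injEq, Pi.zero_apply, zero_mul, Finset.sum_const_zero, add_zero] at hGy
  obtain ⟨g1, g2, g3⟩ := hGy
  refine hm.2 (a * (1 - y 0)) ?_ (fun t => θ t + ∑ i, y i * η i t) ?_ ?_ ⟨0, ?_⟩ g2 g3
  · have := mul_pos ha (hy 0).1
    linarith
  · intro s t
    have hl0 := hm.1 s t
    have hl1 := l1 s t
    have hl2 := l2 s t
    have hl3 := l3 s t
    have hl4 := l4 s t
    have y0 := hy 0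
    have y1 := hy 1
    have y2 := hy 2
    have y3 := hy 3
    have y4 := hy 4
    have hw : 0 ≤ 1 - y 0 - y 1 - y 2 - y 3 - y 4 := by linarith
    have expand : ∀ t, θ t + ∑ i, y i * η i t = (1 - y 0 - y 1 - y 2 - y 3 - y 4) * θ t + y 0 * θ 0
        + y 1 * ψ1 t + y 2 * ψ2 t + y 3 * ψ3 t + y 4 * ψ4 t := by
      intro t
      rw [Fin.sum_univ_five]
      show θ t + (y 0 * (θ 0 - θ t) + y 1 * (ψ1 t - θ t) + y 2 * (ψ2 t - θ t) +
        y 3 * (ψ3 t - θ t) + y 4 * (ψ4 t - θ t)) = _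
      ring
    show |(θ s + ∑ i, y i * η i s) - (θ t + ∑ i, y i * η i t)| ≤ _
    rw [expand, expand]
    rw [abs_le] at *
    have q0 := mul_le_mul_of_nonneg_left hl0.1 hw
    have q0' := mul_le_mul_of_nonneg_left hl0.2 hw
    have q1 := mul_le_mul_of_nonneg_left hl1.1 y1.1.le
    have q1' := mul_le_mul_of_nonneg_left hl1.2 y1.1.le
    have q2 := mul_le_mul_of_nonneg_left hl2.1 y2.1.le
    have q2' := mul_le_mul_of_nonneg_left hl2.2 y2.1.le
    have q3 := mul_le_mul_of_nonneg_left hl3.1 y3.1.le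
    have q3' := mul_le_mul_of_nonneg_left hl3.2 y3.1.le
    have q4 := mul_le_mul_of_nonneg_left hl4.1 y4.1.le
    have q4' := mul_le_mul_of_nonneg_left hl4.2 y4.1.le
    constructor <;> nlinarith
  · show θ 0 + ∑ i, y i * η i 0 = θ 0
    rw [Fin.sum_univ_five]
    show θ 0 + (y 0 * (θ 0 - θ 0) + y 1 * (ψ1 0 - θ 0) + y 2 * (ψ2 0 - θ 0) +
        y 3 * (ψ3 0 - θ 0) + y 4 * (ψ4 0 - θ 0)) = _
    rw [s1, s2, s3, s4]; ring
  · show θ T + ∑ i, y i * η i T = _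
    rw [g1]; simp

theorem pmp0 (T a : ℝ) (hT : 0 < T) (ha : 0 < a) (θ : ℝ → ℝ) (hm : Mini T a θ) :
    ∃ c α β : ℝ, (c, α, β) ≠ (0, 0, 0) ∧ ∀ ψ : ℝ → ℝ, Lip a ψ → ψ 0 = θ 0 →
      c * (ψ T - θ T) + ∫ t in (0:ℝ)..T, (ψ t - θ t) * (-α * sin (θ t) + β * cos (θ t)) ≤ 0 := by
  have hθ : Continuous θ := hm.1.continuous
  obtain ⟨f, hf, h⟩ := exists_support (Kset T a θ) (Kset_convex T a θ hθ)
    ⟨θ, hm.1, rfl, by simp [Lvec]; rfl⟩ (Kset_not_interior T a hT ha θ hm)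
  have hdec : ∀ u v w : ℝ, f (u, v, w) = u * f (1, 0, 0) + v * f (0, 1, 0) + w * f (0, 0, 1) := by
    intro u v w
    have : ((u, v, w) : ℝ × ℝ × ℝ) = u • (1, 0, 0) + v • (0, 1, 0) + w • (0, 0, 1) := by simp
    rw [this]
    simp only [map_add, map_smul, smul_eq_mul]
  refine ⟨f (1, 0, 0), f (0, 1, 0), f (0, 0, 1), ?_, ?_⟩
  · intro h0
    simp only [Prod.mk.injEq] at h0
    apply hf
    refine ContinuousLinearMap.ext fun x => ?_
    obtain ⟨u, v, w⟩ := x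
    rw [hdec, h0.1, h0.2.1, h0.2.2]
    simp
  · intro ψ hψ h0
    have c1 := hψ.continuous
    have := h _ ⟨ψ, hψ, h0, rfl⟩
    rw [Lvec, hdec] at this
    refine le_trans (le_of_eq ?_) this
    rw [mul_comm, add_assoc]
    congr 1
    rw [mul_comm _ (f (0, 1, 0)), mul_comm _ (f (0, 0, 1)),
      ← intervalIntegral.integral_const_mul, ← intervalIntegral.integral_const_mul,
      ← intervalIntegral.integral_add]
    · congr 1; ext t; ring
    · exact Continuous.intervalIntegrable (by fun_prop) _ _
    · exact Continuous.intervalIntegrable (by fun_prop) _ _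

theorem Lip.glue2 {a : ℝ} {f g : ℝ → ℝ} (hf : Lip a f) (hg : Lip a g) (p : ℝ) (h : f p = g p) :
    Lip a (fun t => if t ≤ p then f t else g t) := by
  have key : ∀ x y, x ≤ p → p < y → |f x - g y| ≤ a * |x - y| := by
    intro x y hx hy
    have h1 := hf x p
    have h2 := hg p y
    calc |f x - g y| = |(f x - f p) + (g p - g y)| := by rw [h]; congr 1; ring
      _ ≤ a * |x - p| + a * |p - y| := (abs_add_le _ _).trans (add_le_add h1 h2)
      _ = a * |x - y| := by
        rw [abs_of_nonpos (by linarith), abs_of_nonpos (by linarith), abs_of_nonpos (by linarith)]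
        ring
  intro x y
  by_cases hx : x ≤ p <;> by_cases hy : y ≤ p <;> simp only [hx, hy, if_true, if_false]
  · exact hf x y
  · exact key x y hx (not_le.1 hy)
  · rw [abs_sub_comm, abs_sub_comm x y]; exact key y x hy (not_le.1 hx)
  · exact hg x y

theorem Lip.glue3 {a : ℝ} {f g h : ℝ → ℝ} (hf : Lip a f) (hg : Lip a g) (hh : Lip a h) (p q : ℝ)
    (hpq : p ≤ q) (h1 : f p = g p) (h2 : g q = h q) :
    Lip a (fun t => if t ≤ p then f t else if t ≤ q then g t else h t) := by
  apply Lip.glue2 hf (Lip.glue2 hg hh q h2) p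
  simp [hpq, h1]

theorem Lip.neg {a : ℝ} {f : ℝ → ℝ} (hf : Lip a f) : Lip a (fun t => - f t) := by
  intro x y
  rw [abs_sub_comm]
  convert hf x y using 2
  ring

theorem Lip.add_const {a : ℝ} {f : ℝ → ℝ} (hf : Lip a f) (c : ℝ) : Lip a (fun t => f t + c) := by
  intro x y
  convert hf x y using 2
  ring

theorem Lip.affine {a : ℝ} (ha : 0 ≤ a) (c p : ℝ) : Lip a (fun t => c + a * (t - p)) := by
  intro x y
  apply le_of_eq
  rw [← abs_of_nonneg ha, ← abs_mul, abs_of_nonneg ha]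
  congr 1; ring

/-- `θ` is locally affine with slope `σ` near `x`. -/
def HasSl (θ : ℝ → ℝ) (σ x : ℝ) : Prop := ∀ᶠ y in nhds x, θ y = θ x + σ * (y - x)

theorem HasSl.hasDerivAt {θ : ℝ → ℝ} {σ x : ℝ} (h : HasSl θ σ x) : HasDerivAt θ σ x := by
  have h1 : HasDerivAt (fun y => θ x + σ * (y - x)) σ x := by
    simpa using (((hasDerivAt_id x).sub_const x).const_mul σ).const_add (θ x)
  exact h1.congr_of_eventuallyEq h

theorem affine_of_local {θ : ℝ → ℝ} (hθ : Continuous θ) {σ p q : ℝ}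
    (h : ∀ x ∈ Ioo p q, HasSl θ σ x) : ∀ x ∈ Icc p q, θ x = θ p + σ * (x - p) := by
  intro x hx
  rcases eq_or_lt_of_le hx.1 with h0 | h0
  · subst h0; ring
  by_contra hne
  obtain ⟨ξ, hξ, hd⟩ := exists_hasDerivAt_eq_slope (fun t => θ t - σ * t) (fun t => σ - σ) h0
    (by fun_prop) (fun t ht => by
      have h1 := (h t ⟨ht.1, ht.2.trans_le hx.2⟩).hasDerivAt
      have h2 : HasDerivAt (fun t => σ * t) σ t := by
        simpa using (hasDerivAt_id t).const_mul σ
      exact h1.sub h2)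
  have hxp : x - p ≠ 0 := by linarith
  rw [eq_div_iff hxp] at hd
  apply hne
  linarith

theorem sl_pos_aux (T a c G : ℝ) (θ g : ℝ → ℝ) (hl : Lip a θ) (hg : Continuous g)
    (hG : ∀ x, |g x| ≤ G)
    (hsup : ∀ ψ : ℝ → ℝ, Lip a ψ → ψ 0 = θ 0 →
      c * (ψ T - θ T) + ∫ t in (0:ℝ)..T, (ψ t - θ t) * g t ≤ 0)
    (p q : ℝ) (h0 : 0 ≤ p) (hpq : p < q) (hqT : q ≤ T)
    (hμ : G * (q - p) < c + ∫ t in q..T, g t) : θ q - θ p = a * (q - p) := by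
  have ha := hl.nonneg
  have hθ := hl.continuous
  set D := θ p + a * (q - p) - θ q with hD
  have hDle : ∀ t, p ≤ t → t ≤ q → 0 ≤ θ p + a * (t - p) - θ t ∧ θ p + a * (t - p) - θ t ≤ D := by
    intro t h1 h2
    have e1 := hl t p
    have e2 := hl q t
    rw [abs_of_nonneg (by linarith : (0:ℝ) ≤ t - p)] at e1
    rw [abs_of_nonneg (by linarith : (0:ℝ) ≤ q - t)] at e2
    have := (abs_le.1 e1).2
    have := (abs_le.1 e2).2
    constructor <;> linarith
  have hD0 : 0 ≤ D := (hDle q hpq.le le_rfl).1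
  let ψ : ℝ → ℝ := fun t => if t ≤ p then θ t else if t ≤ q then θ p + a * (t - p) else θ t + D
  have hψ : Lip a ψ := Lip.glue3 hl (Lip.affine ha _ _) (hl.add_const D) p q hpq.le (by simp)
    (by simp [hD])
  have hψ0 : ψ 0 = θ 0 := by simp [ψ, h0]
  have hψc := hψ.continuous
  have hψge : ∀ t, q ≤ t → ψ t = θ t + D := by
    intro t ht
    rcases eq_or_lt_of_le ht with h | h
    · subst h
      simp only [ψ, not_le.2 hpq, if_false, le_refl, if_true, hD]; ring
    · simp only [ψ, not_le.2 h, not_le.2 (hpq.trans h), if_false]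
  have hmain := hsup ψ hψ hψ0
  have ii : ∀ x y, IntervalIntegrable (fun t => (ψ t - θ t) * g t) volume x y := fun x y =>
    Continuous.intervalIntegrable (by fun_prop) _ _
  rw [← intervalIntegral.integral_add_adjacent_intervals (ii 0 p) (ii p T),
    ← intervalIntegral.integral_add_adjacent_intervals (ii p q) (ii q T)] at hmain
  have i1 : (∫ t in (0:ℝ)..p, (ψ t - θ t) * g t) = 0 := by
    rw [intervalIntegral.integral_congr (g := fun _ => (0:ℝ))]
    · simp
    · intro t ht
      rw [uIcc_of_le h0] at ht
      simp [ψ, ht.2]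
  have i3 : (∫ t in q..T, (ψ t - θ t) * g t) = D * ∫ t in q..T, g t := by
    rw [← intervalIntegral.integral_const_mul]
    apply intervalIntegral.integral_congr
    intro t ht
    rw [uIcc_of_le hqT] at ht
    simp only [hψge t ht.1]; ring
  have i2 : |∫ t in p..q, (ψ t - θ t) * g t| ≤ D * G * (q - p) := by
    have := intervalIntegral.norm_integral_le_of_norm_le_const (a := p) (b := q)
      (C := D * G) (f := fun t => (ψ t - θ t) * g t) ?_
    · rwa [Real.norm_eq_abs, abs_of_pos (by linarith : 0 < q - p)] at this
    · intro t ht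
      rw [uIoc_of_le hpq.le] at ht
      have e : ψ t = θ p + a * (t - p) := by simp [ψ, ht.2, not_le.2 ht.1]
      have := hDle t ht.1.le ht.2
      rw [Real.norm_eq_abs, abs_mul, e, abs_of_nonneg this.1]
      have := hG t
      have := this
      gcongr
      linarith
  rw [i1, i3, hψge T hqT] at hmain
  have i2' := (abs_le.1 i2).1
  have : D * ((c + ∫ t in q..T, g t) - G * (q - p)) ≤ 0 := by nlinarith
  have hDz : D ≤ 0 := by
    by_contra hcon
    push Not at hcon
    have := mul_pos hcon (sub_pos.2 hμ)
    linarith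
  have : D = 0 := le_antisymm hDz hD0
  linarith

theorem sl_pos (T a c G : ℝ) (θ g : ℝ → ℝ) (hl : Lip a θ) (hg : Continuous g)
    (hG : ∀ x, |g x| ≤ G)
    (hsup : ∀ ψ : ℝ → ℝ, Lip a ψ → ψ 0 = θ 0 →
      c * (ψ T - θ T) + ∫ t in (0:ℝ)..T, (ψ t - θ t) * g t ≤ 0)
    (x : ℝ) (hx : x ∈ Ioo 0 T) (hμ : 0 < c + ∫ t in x..T, g t) : HasSl θ a x := by
  have hμc : Continuous (fun s => c + ∫ t in s..T, g t) := by
    have : (fun s => c + ∫ t in s..T, g t) = fun s => c - ∫ t in T..s, g t := by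
      ext s; rw [intervalIntegral.integral_symm]; ring
    rw [this]
    exact continuous_const.sub (intervalIntegral.continuous_primitive
      (fun a b => hg.intervalIntegrable a b) T)
  set m := c + ∫ t in x..T, g t with hm
  have hG0 : 0 ≤ G := (abs_nonneg _).trans (hG 0)
  have e1 : ∀ᶠ y in nhds x, m / 2 < c + ∫ t in y..T, g t :=
    hμc.continuousAt.eventually (lt_mem_nhds (by linarith : m / 2 < m))
  have e2 : ∀ᶠ y in nhds x, G * |y - x| < m / 2 := by
    have : Continuous (fun y => G * |y - x|) := by fun_prop
    apply this.continuousAt.eventually (gt_mem_nhds _)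
    simp; linarith
  filter_upwards [e1, e2, isOpen_Ioo.mem_nhds hx] with y h1 h2 h3
  rcases lt_trichotomy x y with h | h | h
  · rw [abs_of_pos (by linarith)] at h2
    have := sl_pos_aux T a c G θ g hl hg hG hsup x y hx.1.le h h3.2.le (h2.trans h1)
    linarith
  · subst h; ring
  · rw [abs_of_neg (by linarith)] at h2
    have := sl_pos_aux T a c G θ g hl hg hG hsup y x h3.1.le h hx.2.le (by linarith)
    linarith

theorem sl_neg (T a c G : ℝ) (θ g : ℝ → ℝ) (hl : Lip a θ) (hg : Continuous g)
    (hG : ∀ x, |g x| ≤ G)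
    (hsup : ∀ ψ : ℝ → ℝ, Lip a ψ → ψ 0 = θ 0 →
      c * (ψ T - θ T) + ∫ t in (0:ℝ)..T, (ψ t - θ t) * g t ≤ 0)
    (x : ℝ) (hx : x ∈ Ioo 0 T) (hμ : c + ∫ t in x..T, g t < 0) : HasSl θ (-a) x := by
  have := sl_pos T a (-c) G (fun t => -θ t) (fun t => -g t) hl.neg hg.neg
    (fun x => by rw [abs_neg]; exact hG x) ?_ x hx
    (by rw [intervalIntegral.integral_neg]; linarith)
  · filter_upwards [this] with y hy
    linarith
  · intro ψ hψ h0
    have := hsup (fun t => - ψ t) hψ.neg (by simp [h0])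
    refine le_trans (le_of_eq ?_) this
    congr 1
    · ring
    · apply intervalIntegral.integral_congr
      intro t _
      simp only []; ring

theorem Lip.add {a b : ℝ} {f g : ℝ → ℝ} (hf : Lip a f) (hg : Lip b g) :
    Lip (a + b) (fun t => f t + g t) := by
  intro x y
  calc |f x + g x - (f y + g y)| = |(f x - f y) + (g x - g y)| := by congr 1; ring
    _ ≤ a * |x - y| + b * |x - y| := (abs_add_le _ _).trans (add_le_add (hf x y) (hg x y))
    _ = _ := by ring

theorem Lip.const_mul {a : ℝ} {f : ℝ → ℝ} (hf : Lip a f) (c : ℝ) :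
    Lip (|c| * a) (fun t => c * f t) := by
  intro x y
  rw [← mul_sub, abs_mul, mul_assoc]
  exact mul_le_mul_of_nonneg_left (hf x y) (abs_nonneg c)

theorem Lip.cos {a : ℝ} {f : ℝ → ℝ} (hf : Lip a f) : Lip a (fun t => Real.cos (f t)) :=
  fun x y => (Real.abs_cos_sub_cos_le _ _).trans (hf x y)

theorem Lip.sin {a : ℝ} {f : ℝ → ℝ} (hf : Lip a f) : Lip a (fun t => Real.sin (f t)) :=
  fun x y => (Real.abs_sin_sub_sin_le _ _).trans (hf x y)

theorem Lip.abs {a : ℝ} {f : ℝ → ℝ} (hf : Lip a f) : Lip a (fun t => |f t|) :=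
  fun x y => (abs_abs_sub_abs_le_abs_sub _ _).trans (hf x y)

theorem Lip.lipschitzWith {a : ℝ} {θ : ℝ → ℝ} (h : Lip a θ) :
    LipschitzWith (Real.toNNReal a) θ := by
  apply LipschitzWith.of_dist_le_mul
  intro x y
  rw [Real.dist_eq, Real.dist_eq]
  refine (h x y).trans ?_
  gcongr
  exact Real.le_coe_toNNReal a

theorem Lip.of_hasDerivAt {f f' : ℝ → ℝ} {G : ℝ} (h : ∀ x, HasDerivAt f (f' x) x)
    (hG : ∀ x, |f' x| ≤ G) : Lip G f := by
  intro x y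
  have := convex_univ.norm_image_sub_le_of_norm_hasDerivWithin_le (f := f) (f' := f') (C := G)
    (fun x _ => (h x).hasDerivWithinAt) (fun x _ => hG x) (mem_univ y) (mem_univ x)
  simpa using this

theorem const_of_ae {L : ℝ} {H : ℝ → ℝ} (hH : Lip L H) (T : ℝ) (hT : 0 ≤ T)
    (h : ∀ᵐ x, x ∈ Ioo 0 T → HasDerivAt H 0 x) : ∀ x ∈ Icc 0 T, H x = H 0 := by
  have hac := (hH.lipschitzWith.lipschitzOnWith (s := uIcc 0 T)).absolutelyContinuousOnInterval
  obtain ⟨C, hC⟩ := hac.const_of_ae_hasDerivAt_zero (by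
    have e1 : ∀ᵐ x : ℝ, x ≠ 0 := by simp [ae_iff, measure_singleton]
    have e2 : ∀ᵐ x : ℝ, x ≠ T := by simp [ae_iff, measure_singleton]
    filter_upwards [h, e1, e2] with x hx h1 h2 hmem
    rw [uIcc_of_le hT] at hmem
    exact hx ⟨lt_of_le_of_ne hmem.1 (Ne.symm h1), lt_of_le_of_ne hmem.2 h2⟩)
  intro x hx
  rw [hC x (by rwa [uIcc_of_le hT]), hC 0 left_mem_uIcc]

theorem hasDerivAt_abs_zero {μ : ℝ → ℝ} {x : ℝ} (h : HasDerivAt μ 0 x) (h0 : μ x = 0) :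
    HasDerivAt (fun t => |μ t|) 0 x := by
  rw [hasDerivAt_iff_isLittleO] at h ⊢
  simp only [h0, abs_zero, sub_zero, smul_zero] at h ⊢
  exact h.abs_left

/-- a differentiability point of `θ` cannot be a transversal zero of `μ` -/
theorem no_transversal {T a : ℝ} (ha : 0 < a) {θ μ : ℝ → ℝ} (hθ : Continuous θ)
    (hpos : ∀ x ∈ Ioo 0 T, 0 < μ x → HasSl θ a x)
    (hneg : ∀ x ∈ Ioo 0 T, μ x < 0 → HasSl θ (-a) x)
    {x : ℝ} (hx : x ∈ Ioo 0 T) (h0 : μ x = 0) {m : ℝ} (hm : HasDerivAt μ m x) (hm0 : 0 < m)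
    {e : ℝ} (hd : HasDerivAt θ e x) : False := by
  have hs := hm.tendsto_slope.eventually (lt_mem_nhds hm0)
  have hs' := eventually_nhdsWithin_iff.1 hs
  obtain ⟨ε, hε, hball⟩ := Metric.eventually_nhds_iff.1 (hs'.and (isOpen_Ioo.mem_nhds hx))
  have hr : ∀ y, x < y → y < x + ε → θ y = θ x + a * (y - x) := by
    intro y h1 h2
    apply affine_of_local hθ (q := y) _ y ⟨h1.le, le_rfl⟩
    intro w hw
    have hb := hball (y := w) (by rw [Real.dist_eq, abs_of_pos] <;> linarith [hw.1, hw.2])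
    apply hpos w hb.2
    have := hb.1 (ne_of_gt hw.1)
    rw [slope_def_field, h0, sub_zero] at this
    exact (div_pos_iff_of_pos_right (sub_pos.2 hw.1)).1 this
  have hlft : ∀ y, x - ε < y → y < x → θ y = θ x + (-a) * (y - x) := by
    intro y h1 h2
    have := affine_of_local hθ (p := y) (q := x) (σ := -a) ?_ x ⟨h2.le, le_rfl⟩
    · linarith
    intro w hw
    have hb := hball (y := w) (by rw [Real.dist_eq, abs_of_neg] <;> linarith [hw.1, hw.2])
    apply hneg w hb.2
    have := hb.1 (ne_of_lt hw.2)
    rw [slope_def_field, h0, sub_zero] at this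
    by_contra hcon
    push Not at hcon
    have := div_nonpos_of_nonneg_of_nonpos hcon (sub_nonpos.2 hw.2.le)
    linarith
  have t := hd.tendsto_slope
  have t1 : Filter.Tendsto (slope θ x) (nhdsWithin x (Ioi x)) (nhds e) :=
    t.mono_left (nhdsWithin_mono _ (fun y hy => ne_of_gt hy))
  have t2 : Filter.Tendsto (slope θ x) (nhdsWithin x (Iio x)) (nhds e) :=
    t.mono_left (nhdsWithin_mono _ (fun y hy => ne_of_lt hy))
  have u1 : Filter.Tendsto (slope θ x) (nhdsWithin x (Ioi x)) (nhds a) := by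
    apply tendsto_const_nhds.congr'
    filter_upwards [Ioo_mem_nhdsGT (by linarith : x < x + ε)] with y hy
    have : y - x ≠ 0 := by linarith [hy.1]
    rw [slope_def_field, hr y hy.1 hy.2]
    field_simp
    ring
  have u2 : Filter.Tendsto (slope θ x) (nhdsWithin x (Iio x)) (nhds (-a)) := by
    apply tendsto_const_nhds.congr'
    filter_upwards [Ioo_mem_nhdsLT (by linarith : x - ε < x)] with y hy
    have : y - x ≠ 0 := by linarith [hy.2]
    rw [slope_def_field, hlft y hy.1 hy.2]
    field_simp
    ring
  have := tendsto_nhds_unique t1 u1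
  have := tendsto_nhds_unique t2 u2
  linarith

theorem ham_const {T a α β : ℝ} (hT : 0 < T) (ha : 0 < a) {θ μ : ℝ → ℝ} (hl : Lip a θ)
    (hd : ∀ x, HasDerivAt μ (α * sin (θ x) - β * cos (θ x)) x)
    (hpos : ∀ x ∈ Ioo 0 T, 0 < μ x → HasSl θ a x)
    (hneg : ∀ x ∈ Ioo 0 T, μ x < 0 → HasSl θ (-a) x) :
    ∃ h, ∀ x ∈ Icc 0 T, a * |μ x| + (α * cos (θ x) + β * sin (θ x)) = h := by
  have hμl : Lip (|α| + |β|) μ := by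
    apply Lip.of_hasDerivAt hd
    intro x
    refine (abs_sub _ _).trans ?_
    rw [abs_mul, abs_mul]
    have := abs_sin_le_one (θ x)
    have := abs_cos_le_one (θ x)
    have := abs_nonneg α
    have := abs_nonneg β
    nlinarith
  have hHl := (hμl.abs.const_mul a).add ((hl.cos.const_mul α).add (hl.sin.const_mul β))
  refine ⟨_, const_of_ae hHl T hT.le ?_⟩
  filter_upwards [hl.lipschitzWith.ae_differentiableAt_real] with x hdiff hx
  have hdx := hdiff.hasDerivAt
  set e := deriv θ x
  have h2 : HasDerivAt (fun t => α * cos (θ t) + β * sin (θ t))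
      (α * (-sin (θ x) * e) + β * (cos (θ x) * e)) x :=
    (hdx.cos.const_mul α).add (hdx.sin.const_mul β)
  rcases lt_trichotomy (μ x) 0 with hm | hm | hm
  · have he : e = -a := hdx.unique (hneg x hx hm).hasDerivAt
    have h1 := ((hasDerivAt_abs_neg hm).comp x (hd x)).const_mul a
    have := h1.add h2
    refine HasDerivAt.congr_deriv this ?_
    rw [he]; ring
  · by_cases hg : α * sin (θ x) - β * cos (θ x) = 0
    · have h0 := hd x
      rw [hg] at h0
      have := ((hasDerivAt_abs_zero h0 hm).const_mul a).add h2
      refine HasDerivAt.congr_deriv this ?_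
      linear_combination -e * hg
    · exfalso
      rcases lt_or_gt_of_ne hg with h | h
      · refine no_transversal (T := T) (θ := fun t => - θ t) (μ := fun t => - μ t) ha
          hl.continuous.neg ?_ ?_ hx (by simp [hm]) (hd x).neg (by linarith) hdx.neg
        · intro y hy hμ
          filter_upwards [hneg y hy (by linarith)] with w hw
          linarith
        · intro y hy hμ
          filter_upwards [hpos y hy (by linarith)] with w hw
          linarith
      · exact no_transversal ha hl.continuous hpos hneg hx hm (hd x) h hdx
  · have he : e = a := hdx.unique (hpos x hx hm).hasDerivAt
    have h1 := ((hasDerivAt_abs_pos hm).comp x (hd x)).const_mul a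
    have := h1.add h2
    refine HasDerivAt.congr_deriv this ?_
    rw [he]; ring

theorem structP {T a : ℝ} (hT : 0 < T) (ha : 0 < a) {θ : ℝ → ℝ} (hm : Mini T a θ) :
    ∃ μ : ℝ → ℝ, Continuous μ ∧ (∀ x ∈ Ioo 0 T, 0 < μ x → HasSl θ a x) ∧
      (∀ x ∈ Ioo 0 T, μ x < 0 → HasSl θ (-a) x) ∧
      ((∀ x ∈ Icc 0 T, μ x ≠ 0) ∨ ∃ d h : ℝ, (∀ x, HasDerivAt μ (sin (θ x - d)) x) ∧
        ∀ x ∈ Icc 0 T, a * |μ x| = h - cos (θ x - d)) := by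
  obtain ⟨c, α, β, hne, hsup⟩ := pmp0 T a hT ha θ hm
  have hl := hm.1
  have hθ := hl.continuous
  set g : ℝ → ℝ := fun t => -α * sin (θ t) + β * cos (θ t) with hg
  have hgc : Continuous g := by fun_prop
  have hG : ∀ x, |g x| ≤ |α| + |β| := by
    intro x
    refine (abs_add_le _ _).trans ?_
    rw [abs_mul, abs_mul, abs_neg]
    have := abs_sin_le_one (θ x)
    have := abs_cos_le_one (θ x)
    have := abs_nonneg α
    have := abs_nonneg β
    nlinarith
  let μ : ℝ → ℝ := fun s => c + ∫ t in s..T, g t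
  have hpos : ∀ x ∈ Ioo 0 T, 0 < μ x → HasSl θ a x := fun x hx h =>
    sl_pos T a c _ θ g hl hgc hG hsup x hx h
  have hneg : ∀ x ∈ Ioo 0 T, μ x < 0 → HasSl θ (-a) x := fun x hx h =>
    sl_neg T a c _ θ g hl hgc hG hsup x hx h
  have hd : ∀ x, HasDerivAt μ (α * sin (θ x) - β * cos (θ x)) x := by
    intro x
    have := (intervalIntegral.integral_hasDerivAt_left (hgc.intervalIntegrable x T)
      (hgc.stronglyMeasurableAtFilter _ _) hgc.continuousAt).const_add c
    refine HasDerivAt.congr_deriv this ?_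
    simp [hg]; ring
  have hμc : Continuous μ := continuous_iff_continuousAt.2 fun x => (hd x).continuousAt
  by_cases hz : α = 0 ∧ β = 0
  · obtain ⟨rfl, rfl⟩ := hz
    have hc : c ≠ 0 := by rintro rfl; exact hne rfl
    refine ⟨μ, hμc, hpos, hneg, Or.inl fun x _ => ?_⟩
    simpa [μ, hg] using hc
  · obtain ⟨h, hh⟩ := ham_const hT ha hl hd hpos hneg
    set w : ℂ := ⟨α, β⟩ with hw
    have hw0 : w ≠ 0 := by
      intro h0; apply hz
      exact ⟨by simpa [hw] using congrArg Complex.re h0, by simpa [hw] using congrArg Complex.im h0⟩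
    set ρ := ‖w‖ with hρd
    have hρ : 0 < ρ := norm_pos_iff.2 hw0
    set d := Complex.arg w with hdd
    have e1 : α = ρ * cos d := (Complex.norm_mul_cos_arg w).symm
    have e2 : β = ρ * sin d := (Complex.norm_mul_sin_arg w).symm
    refine ⟨fun s => μ s / ρ, hμc.div_const ρ, ?_, ?_, Or.inr ⟨d, h / ρ, ?_, ?_⟩⟩
    · intro x hx h; exact hpos x hx ((div_pos_iff_of_pos_right hρ).1 h)
    · intro x hx h
      apply hneg x hx
      by_contra hcon
      push Not at hcon
      have := div_nonneg hcon hρ.le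
      linarith
    · intro x
      have := (hd x).div_const ρ
      refine HasDerivAt.congr_deriv this ?_
      rw [e1, e2, sin_sub]
      field_simp
    · intro x hx
      have := hh x hx
      rw [abs_div, abs_of_pos hρ, ← this, cos_sub, e1, e2]
      field_simp
      ring

theorem Mini.transfer {T a : ℝ} {θ ψ : ℝ → ℝ} (hm : Mini T a θ) (hl : Lip a ψ) (h0 : ψ 0 = θ 0)
    (hT : ∃ k : ℤ, ψ T = θ T + k * (2 * π))
    (hc : (∫ t in (0:ℝ)..T, cos (ψ t)) = ∫ t in (0:ℝ)..T, cos (θ t))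
    (hs : (∫ t in (0:ℝ)..T, sin (ψ t)) = ∫ t in (0:ℝ)..T, sin (θ t)) : Mini T a ψ := by
  obtain ⟨k, hk⟩ := hT
  refine ⟨hl, fun b hb χ hχ c0 hcT cc cs => ?_⟩
  obtain ⟨j, hj⟩ := hcT
  refine hm.2 b hb χ hχ (c0.trans h0) ⟨j + k, ?_⟩ (cc.trans hc) (cs.trans hs)
  rw [hj, hk]; push_cast; ring

/-- reversal of the part `[p, q]` -/
def rev (θ : ℝ → ℝ) (p q c : ℝ) (t : ℝ) : ℝ :=
  if t ≤ p then θ t else if t ≤ q then θ (p + q - t) - c else θ t - 2 * c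

theorem rev_le {θ : ℝ → ℝ} {p q c t : ℝ} (h : t ≤ p) : rev θ p q c t = θ t := by simp [rev, h]

theorem rev_mid {θ : ℝ → ℝ} {p q c t : ℝ} (hc : θ q = θ p + c) (h : p ≤ t) (h2 : t ≤ q) :
    rev θ p q c t = θ (p + q - t) - c := by
  rcases eq_or_lt_of_le h with h | h
  · subst h; simp [rev, hc]
  · simp [rev, not_le.2 h, h2]

theorem rev_ge {θ : ℝ → ℝ} {p q c t : ℝ} (hpq : p ≤ q) (hc : θ q = θ p + c) (h : q ≤ t) :
    rev θ p q c t = θ t - 2 * c := by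
  rcases eq_or_lt_of_le h with h | h
  · subst h
    rw [rev_mid hc hpq le_rfl, hc]
    simp; ring
  · simp [rev, not_le.2 h, not_le.2 (hpq.trans_lt h)]

theorem rev_int {θ : ℝ → ℝ} (hθ : Continuous θ) {T p q : ℝ} (h0 : 0 ≤ p) (hpq : p ≤ q) (hqT : q ≤ T)
    (k : ℤ) (hk : θ q = θ p + k * (2 * π)) (hr : Continuous (rev θ p q (k * (2 * π))))
    (f : ℝ → ℝ) (hf : Continuous f) (hper : ∀ x (n : ℤ), f (x - n * (2 * π)) = f x) :
    (∫ t in (0:ℝ)..T, f (rev θ p q (k * (2 * π)) t)) = ∫ t in (0:ℝ)..T, f (θ t) := by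
  have i1 : ∀ x y, IntervalIntegrable (fun t => f (θ t)) volume x y := fun x y =>
    Continuous.intervalIntegrable (by fun_prop) _ _
  have i2 : ∀ x y, IntervalIntegrable (fun t => f (rev θ p q (k * (2 * π)) t)) volume x y :=
    fun x y => Continuous.intervalIntegrable (by fun_prop) _ _
  rw [← intervalIntegral.integral_add_adjacent_intervals (i1 0 p) (i1 p T),
    ← intervalIntegral.integral_add_adjacent_intervals (i1 p q) (i1 q T),
    ← intervalIntegral.integral_add_adjacent_intervals (i2 0 p) (i2 p T),
    ← intervalIntegral.integral_add_adjacent_intervals (i2 p q) (i2 q T)]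
  congr 1
  · apply intervalIntegral.integral_congr
    intro t ht
    rw [uIcc_of_le h0] at ht
    simp only [rev_le ht.2]
  congr 1
  · have : (∫ t in p..q, f (rev θ p q (k * (2 * π)) t)) =
        ∫ t in p..q, (fun s => f (θ s)) (p + q - t) := by
      apply intervalIntegral.integral_congr
      intro t ht
      rw [uIcc_of_le hpq] at ht
      simp only [rev_mid hk ht.1 ht.2, hper]
    rw [this]
    refine (intervalIntegral.integral_comp_sub_left (fun s => f (θ s)) (p + q)).trans ?_
    simp
  · apply intervalIntegral.integral_congr
    intro t ht
    rw [uIcc_of_le hqT] at ht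
    have := hper (θ t) (2 * k)
    push_cast at this
    simp only [rev_ge hpq hk ht.1]
    rw [← this]
    congr 1; ring

theorem Mini.rev {T a : ℝ} {θ : ℝ → ℝ} (hm : Mini T a θ) {p q : ℝ} (h0 : 0 ≤ p) (hpq : p ≤ q)
    (hqT : q ≤ T) (k : ℤ) (hk : θ q = θ p + k * (2 * π)) :
    Mini T a (rev θ p q (k * (2 * π))) := by
  have hl := hm.1
  have h1 : Lip a (fun t => θ (p + q - t) - k * (2 * π)) := by
    intro x y
    have := hl (p + q - x) (p + q - y)
    rw [abs_sub_comm x y]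
    convert this using 2
    · ring
    · congr 1; ring
  have h2 : Lip a (fun t => θ t - 2 * (k * (2 * π))) := hl.add_const _
  have hr : Lip a (_root_.rev θ p q (k * (2 * π))) := by
    have := Lip.glue3 hl h1 h2 p q hpq (by simp [hk]) (by simp [hk]; ring)
    exact this
  refine hm.transfer hr (rev_le h0) ⟨-2 * k, ?_⟩ ?_ ?_
  · rw [rev_ge hpq hk hqT]; push_cast; ring
  · exact rev_int hl.continuous h0 hpq hqT k hk hr.continuous cos continuous_cos
      (fun x n => Real.cos_sub_int_mul_two_pi x n)
  · exact rev_int hl.continuous h0 hpq hqT k hk hr.continuous sin continuous_sin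
      (fun x n => Real.sin_sub_int_mul_two_pi x n)

/-- a corner: slope `s` on the left and `-s` on the right -/
def Corner (θ : ℝ → ℝ) (s p : ℝ) : Prop := ∀ᶠ y in nhds p, θ y = θ p - s * |y - p|

def Reg (a : ℝ) (θ : ℝ → ℝ) (x : ℝ) : Prop := HasSl θ a x ∨ HasSl θ (-a) x

theorem HasSl.eventually {θ : ℝ → ℝ} {σ x : ℝ} (h : HasSl θ σ x) :
    ∀ᶠ y in nhds x, HasSl θ σ y := by
  have h' : ∀ᶠ y in nhds x, θ y = θ x + σ * (y - x) := h
  filter_upwards [h'.eventually_nhds, h'] with y hy hy2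
  filter_upwards [hy] with w hw
  rw [hw, hy2]; ring

theorem Corner.right {θ : ℝ → ℝ} {s p : ℝ} (h : Corner θ s p) :
    ∀ᶠ y in nhdsWithin p (Ioi p), HasSl θ (-s) y := by
  have h' : ∀ᶠ y in nhds p, θ y = θ p - s * |y - p| := h
  filter_upwards [nhdsWithin_le_nhds h'.eventually_nhds, nhdsWithin_le_nhds h',
    self_mem_nhdsWithin] with y hy hy2 hyp
  filter_upwards [hy, isOpen_Ioi.mem_nhds hyp] with w hw hwp
  have hyp : p < y := hyp
  have hwp : p < w := hwp
  rw [hw, hy2, abs_of_pos (by linarith), abs_of_pos (by linarith)]; ring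

theorem Corner.left {θ : ℝ → ℝ} {s p : ℝ} (h : Corner θ s p) :
    ∀ᶠ y in nhdsWithin p (Iio p), HasSl θ s y := by
  have h' : ∀ᶠ y in nhds p, θ y = θ p - s * |y - p| := h
  filter_upwards [nhdsWithin_le_nhds h'.eventually_nhds, nhdsWithin_le_nhds h',
    self_mem_nhdsWithin] with y hy hy2 hyp
  filter_upwards [hy, isOpen_Iio.mem_nhds hyp] with w hw hwp
  have hyp : y < p := hyp
  have hwp : w < p := hwp
  rw [hw, hy2, abs_of_neg (by linarith), abs_of_neg (by linarith)]; ring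

theorem HasSl.unique {θ : ℝ → ℝ} {σ τ x : ℝ} (h : HasSl θ σ x) (h2 : HasSl θ τ x) : σ = τ :=
  h.hasDerivAt.unique h2.hasDerivAt

theorem Corner.not_sl {θ : ℝ → ℝ} {s σ p : ℝ} (h : Corner θ s p) (hs : s ≠ 0)
    (h2 : HasSl θ σ p) : False := by
  obtain ⟨y, hy1, hy2⟩ := (h.right.and (nhdsWithin_le_nhds h2.eventually)).exists
  obtain ⟨w, hw1, hw2⟩ := (h.left.and (nhdsWithin_le_nhds h2.eventually)).exists
  have := hy1.unique hy2
  have := hw1.unique hw2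
  apply hs; linarith

theorem heading_eq {x y d : ℝ} (h1 : cos (x - d) = cos (y - d)) (h2 : sin (y - d) = 0) :
    ∃ k : ℤ, x = y + k * (2 * π) := by
  have h3 := sin_sq_add_cos_sq (x - d)
  have h4 := sin_sq_add_cos_sq (y - d)
  have h5 : cos (x - y) = 1 := by
    have e : x - y = (x - d) - (y - d) := by ring
    rw [e, cos_sub, h2, h1]
    rw [h2] at h4
    linarith
  obtain ⟨k, hk⟩ := (cos_eq_one_iff _).1 h5
  exact ⟨k, by linarith⟩

theorem deriv_sign {μ : ℝ → ℝ} {m p : ℝ} (h : HasDerivAt μ m p) (h0 : μ p = 0)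
    (he : ∀ᶠ y in nhdsWithin p (Ioi p), μ y ≤ 0) : m ≤ 0 := by
  have t1 : Filter.Tendsto (slope μ p) (nhdsWithin p (Ioi p)) (nhds m) :=
    h.tendsto_slope.mono_left (nhdsWithin_mono _ (fun y hy => ne_of_gt hy))
  apply le_of_tendsto t1
  filter_upwards [he, self_mem_nhdsWithin] with y hy hyp
  have hyp : p < y := hyp
  rw [slope_def_field, h0, sub_zero]
  exact div_nonpos_of_nonpos_of_nonneg hy (by linarith)

theorem cornersC {T a : ℝ} (hT : 0 < T) (ha : 0 < a) {θ : ℝ → ℝ} (hm : Mini T a θ) {p q : ℝ}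
    (hp : p ∈ Ioo 0 T) (hq : q ∈ Ioo 0 T) (cp : Corner θ a p) (cq : Corner θ (-a) q) (k : ℤ)
    (hk : θ q = θ p + k * (2 * π)) {τ : ℝ} (hτ : τ ∈ Ioo 0 T)
    (hne : ¬ ∃ j : ℤ, θ τ = θ p + j * (2 * π)) : Reg a θ τ := by
  obtain ⟨μ, hμc, hpos, hneg, hz⟩ := structP hT ha hm
  have zero_of : ∀ x ∈ Ioo 0 T, ¬ HasSl θ a x → ¬ HasSl θ (-a) x → μ x = 0 := by
    intro x hx h1 h2
    rcases lt_trichotomy (μ x) 0 with h | h | h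
    · exact absurd (hneg x hx h) h2
    · exact h
    · exact absurd (hpos x hx h) h1
  have hμp : μ p = 0 := zero_of p hp (cp.not_sl ha.ne') (cp.not_sl ha.ne')
  have hμq : μ q = 0 := zero_of q hq (cq.not_sl (by linarith [ha] : -a < 0).ne)
    (cq.not_sl (by linarith [ha] : -a < 0).ne)
  rcases hz with hz | ⟨d, h, hd, hh⟩
  · exact absurd hμp (hz p (Ioo_subset_Icc_self hp))
  have s1 : sin (θ p - d) ≤ 0 := by
    apply deriv_sign (hd p) hμp
    filter_upwards [cp.right, nhdsWithin_le_nhds (isOpen_Ioo.mem_nhds hp)] with y hy hyT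
    by_contra hcon
    have := (hpos y hyT (not_le.1 hcon)).unique hy
    linarith
  have s2 : -sin (θ q - d) ≤ 0 := by
    apply deriv_sign (hd q).neg (by simp [hμq])
    filter_upwards [cq.right, nhdsWithin_le_nhds (isOpen_Ioo.mem_nhds hq)] with y hy hyT
    by_contra hcon
    have := (hneg y hyT (by simp at hcon; linarith)).unique hy
    linarith
  have s3 : sin (θ q - d) = sin (θ p - d) := by
    rw [hk, ← Real.sin_add_int_mul_two_pi (θ p - d) k]; congr 1; ring
  have s4 : sin (θ p - d) = 0 := by rw [s3] at s2; linarith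
  rcases lt_trichotomy (μ τ) 0 with h' | h' | h'
  · exact Or.inr (hneg τ hτ h')
  · exfalso
    apply hne
    have e1 := hh p (Ioo_subset_Icc_self hp)
    have e2 := hh τ (Ioo_subset_Icc_self hτ)
    rw [hμp] at e1
    rw [h'] at e2
    exact heading_eq (d := d) (by simp at e1 e2; linarith) s4
  · exact Or.inl (hpos τ hτ h')

theorem lemY_aux {T a : ℝ} (hT : 0 < T) (ha : 0 < a) {θ : ℝ → ℝ} (hm : Mini T a θ) {p q σ : ℝ}
    (hp : 0 < p) (hpq : p < q) (hq : q < T) (hσ : σ = a ∨ σ = -a)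
    (sp : HasSl θ σ p) (sq : HasSl θ σ q) (k : ℤ)
    (hk : θ q = θ p + k * (2 * π)) {τ : ℝ} (hτ : τ ∈ Ioo 0 T)
    (hne : ¬ ∃ j : ℤ, θ τ = θ p + j * (2 * π)) : Reg a θ τ := by
  set c : ℝ := k * (2 * π) with hc
  have hmr := hm.rev hp.le hpq.le hq.le k hk
  rw [← hc] at hmr
  have rp : rev θ p q c p = θ p := rev_le le_rfl
  have rq : rev θ p q c q = θ p - c := by rw [rev_mid hk hpq.le le_rfl]; simp
  have cp : Corner (rev θ p q c) σ p := by
    have t : Filter.Tendsto (fun y => p + q - y) (nhds p) (nhds q) := by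
      have : Continuous (fun y : ℝ => p + q - y) := by fun_prop
      simpa using this.tendsto p
    filter_upwards [show ∀ᶠ y in nhds p, θ y = θ p + σ * (y - p) from sp,
      t.eventually (show ∀ᶠ y in nhds q, θ y = θ q + σ * (y - q) from sq),
      gt_mem_nhds hpq] with y h1 h2 h3
    rw [rp]
    rcases le_total y p with h | h
    · rw [rev_le h, h1, abs_of_nonpos (by linarith)]; ring
    · rw [rev_mid hk h h3.le, h2, abs_of_nonneg (by linarith), hk]; ring
  have cq : Corner (rev θ p q c) (-σ) q := by
    have t : Filter.Tendsto (fun y => p + q - y) (nhds q) (nhds p) := by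
      have : Continuous (fun y : ℝ => p + q - y) := by fun_prop
      simpa using this.tendsto q
    filter_upwards [show ∀ᶠ y in nhds q, θ y = θ q + σ * (y - q) from sq,
      t.eventually (show ∀ᶠ y in nhds p, θ y = θ p + σ * (y - p) from sp),
      lt_mem_nhds hpq] with y h1 h2 h3
    rw [rq]
    rcases le_total y q with h | h
    · rw [rev_mid hk h3.le h, h2, abs_of_nonpos (by linarith)]; ring
    · rw [rev_ge hpq.le hk h, h1, abs_of_nonneg (by linarith), hk]; ring
  have main : ∀ s ∈ Ioo 0 T, (¬ ∃ j : ℤ, rev θ p q c s = θ p + j * (2 * π)) →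
      Reg a (rev θ p q c) s := by
    intro s hs hns
    rcases hσ with rfl | rfl
    · exact cornersC hT ha hmr ⟨hp, hpq.trans hq⟩ ⟨hp.trans hpq, hq⟩ cp cq (-k)
        (by rw [rp, rq, hc]; push_cast; ring) hs (by rwa [rp])
    · rw [neg_neg] at cq
      refine cornersC hT ha hmr ⟨hp.trans hpq, hq⟩ ⟨hp, hpq.trans hq⟩ cq cp k
        (by rw [rp, rq, hc]; ring) hs ?_
      rintro ⟨j, hj⟩
      apply hns
      refine ⟨j - k, ?_⟩
      rw [hj, rq, hc]; push_cast; ring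
  rcases lt_trichotomy τ p with h | h | h
  · have := main τ hτ (by rwa [rev_le h.le])
    have key : ∀ σ, HasSl (rev θ p q c) σ τ → HasSl θ σ τ := by
      intro σ hs
      filter_upwards [show ∀ᶠ y in nhds τ, _ = _ from hs, gt_mem_nhds h] with y h1 h2
      rwa [rev_le h2.le, rev_le h.le] at h1
    exact this.imp (key _) (key _)
  · subst h
    exact absurd ⟨0, by simp⟩ hne
  rcases lt_trichotomy τ q with h2 | h2 | h2
  · have hτ' : p + q - τ ∈ Ioo 0 T := ⟨by linarith, by linarith⟩
    have e : p + q - (p + q - τ) = τ := by ring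
    have := main (p + q - τ) hτ' (by
      rw [rev_mid hk (by linarith) (by linarith), e]
      rintro ⟨j, hj⟩
      apply hne
      refine ⟨j + k, ?_⟩
      push_cast
      linarith)
    have key : ∀ σ, HasSl (rev θ p q c) σ (p + q - τ) → HasSl θ (-σ) τ := by
      intro σ hs
      have t : Filter.Tendsto (fun y => p + q - y) (nhds τ) (nhds (p + q - τ)) := by
        have : Continuous (fun y : ℝ => p + q - y) := by fun_prop
        exact this.tendsto τ
      filter_upwards [t.eventually (show ∀ᶠ y in nhds (p + q - τ), _ = _ from hs),
        gt_mem_nhds h2, lt_mem_nhds h] with y h1 h3 h4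
      rw [rev_mid hk (by linarith) (by linarith), rev_mid hk (by linarith) (by linarith), e] at h1
      have e2 : p + q - (p + q - y) = y := by ring
      rw [e2] at h1
      linarith
    rcases this with h5 | h5
    · exact Or.inr (key _ h5)
    · have := key _ h5
      rw [neg_neg] at this
      exact Or.inl this
  · subst h2
    exact absurd ⟨k, hk⟩ hne
  · have := main τ hτ (by
      rw [rev_ge hpq.le hk h2.le]
      rintro ⟨j, hj⟩
      apply hne
      refine ⟨j + 2 * k, ?_⟩
      push_cast
      linarith)
    have key : ∀ σ, HasSl (rev θ p q c) σ τ → HasSl θ σ τ := by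
      intro σ hs
      filter_upwards [show ∀ᶠ y in nhds τ, _ = _ from hs, lt_mem_nhds h2] with y h1 h3
      rw [rev_ge hpq.le hk h2.le, rev_ge hpq.le hk h3.le] at h1
      linarith
    exact this.imp (key _) (key _)

theorem lemY {T a : ℝ} (hT : 0 < T) (ha : 0 < a) {θ : ℝ → ℝ} (hm : Mini T a θ) {p q σ : ℝ}
    (hp : 0 < p) (hpq : p < q) (hq : q < T) (hσ : σ = a ∨ σ = -a)
    (sp : HasSl θ σ p) (sq : HasSl θ σ q) (k : ℤ)
    (hk : θ q = θ p + k * (2 * π)) : ∀ τ ∈ Ioo 0 T, Reg a θ τ := by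
  intro τ hτ
  by_cases hne : ∃ j : ℤ, θ τ = θ p + j * (2 * π)
  · have t : Filter.Tendsto (fun δ : ℝ => p + δ) (nhds 0) (nhds p) := by
      have : Continuous (fun y : ℝ => p + y) := by fun_prop
      simpa using this.tendsto 0
    have t2 : Filter.Tendsto (fun δ : ℝ => q + δ) (nhds 0) (nhds q) := by
      have : Continuous (fun y : ℝ => q + y) := by fun_prop
      simpa using this.tendsto 0
    have ev := ((((((t.eventually sp.eventually).and (t2.eventually sq.eventually)).and
      (t.eventually (show ∀ᶠ y in nhds p, θ y = θ p + σ * (y - p) from sp))).and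
      (t2.eventually (show ∀ᶠ y in nhds q, θ y = θ q + σ * (y - q) from sq))).and
      (t2.eventually (gt_mem_nhds hq))).and
      (gt_mem_nhds (show (0:ℝ) < 2 * π / a by positivity)))
    have ev2 := (ev.filter_mono (nhdsWithin_le_nhds (s := Ioi (0:ℝ)))).and self_mem_nhdsWithin
    obtain ⟨δ, ⟨⟨⟨⟨⟨h1, h2⟩, h3⟩, h4⟩, h5⟩, h6⟩, h7⟩ := ev2.exists
    have h7 : 0 < δ := h7
    rw [add_sub_cancel_left] at h3 h4
    refine lemY_aux hT ha hm (p := p + δ) (q := q + δ) (by linarith) (by linarith) h5 hσ h1 h2 k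
      (by rw [h3, h4, hk]; ring) hτ ?_
    rintro ⟨i, hi⟩
    obtain ⟨j, hj⟩ := hne
    rw [h3, hj] at hi
    have e : σ * δ = ((j - i : ℤ) : ℝ) * (2 * π) := by push_cast; linarith
    have habs : |σ * δ| = a * δ := by
      rw [abs_mul, abs_of_pos h7]
      rcases hσ with rfl | rfl
      · rw [abs_of_pos ha]
      · rw [abs_neg, abs_of_pos ha]
    have hlt : a * δ < 2 * π := by
      rw [lt_div_iff₀ ha] at h6; linarith
    rw [e, abs_mul, abs_of_pos (by positivity : 0 < 2 * π)] at habs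
    have hji : (j - i : ℤ) ≠ 0 := by
      intro h0
      rw [h0] at habs
      have := mul_pos ha h7
      simp at habs
      rcases habs with h | h <;> linarith
    have : (1:ℝ) ≤ |((j - i : ℤ) : ℝ)| := by
      exact_mod_cast Int.one_le_abs hji
    nlinarith [pi_pos]
  · exact lemY_aux hT ha hm hp hpq hq hσ sp sq k hk hτ hne

theorem affine_of_reg {a p q : ℝ} (ha : 0 < a) {θ : ℝ → ℝ} (hθ : Continuous θ)
    (h : ∀ x ∈ Ioo p q, Reg a θ x) :
    ∃ σ, (σ = a ∨ σ = -a) ∧ ∀ x ∈ Icc p q, θ x = θ p + σ * (x - p) := by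
  have ho : ∀ σ, IsOpen {x | HasSl θ σ x} := fun σ =>
    isOpen_iff_mem_nhds.2 fun x hx => HasSl.eventually hx
  have hdisj : Disjoint {x | HasSl θ a x} {x | HasSl θ (-a) x} := by
    rw [Set.disjoint_left]
    intro x h1 h2
    have := HasSl.unique h1 h2
    linarith
  rcases isPreconnected_Ioo.subset_or_subset (ho a) (ho (-a)) hdisj
    (fun x hx => h x hx) with h1 | h1
  · exact ⟨a, Or.inl rfl, affine_of_local hθ h1⟩
  · exact ⟨-a, Or.inr rfl, affine_of_local hθ h1⟩

def Aff (θ : ℝ → ℝ) (σ p q : ℝ) : Prop := ∀ x ∈ Icc p q, θ x = θ p + σ * (x - p)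

def Good (T a : ℝ) (θ : ℝ → ℝ) : Prop :=
  ∃ s1 s2 : ℝ, 0 ≤ s1 ∧ s1 ≤ s2 ∧ s2 ≤ T ∧
      ∃ ω1 ω2 ω3 : ℝ,
        ω1 ∈ ({-a, 0, a} : Set ℝ) ∧ ω2 ∈ ({-a, 0, a} : Set ℝ) ∧
        ω3 ∈ ({-a, 0, a} : Set ℝ) ∧ Aff θ ω1 0 s1 ∧ Aff θ ω2 s1 s2 ∧ Aff θ ω3 s2 T ∧
        ((ω1 = 0 ∧ ω3 = 0 ∧ 0 < s1 ∧ s2 < T ∧ ω2 ≠ 0) → a * (s2 - s1) = 2 * π)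

theorem mem3 {a σ : ℝ} (h : σ = a ∨ σ = -a) : σ ∈ ({-a, 0, a} : Set ℝ) := by
  rcases h with h | h <;> simp [h]

theorem ne0 {a σ : ℝ} (ha : 0 < a) (h : σ = a ∨ σ = -a) : σ ≠ 0 := by
  rcases h with h | h <;> rw [h] <;> linarith [ha]

theorem aff_triv (θ : ℝ → ℝ) (σ p : ℝ) : Aff θ σ p p := by
  intro x hx
  have : x = p := le_antisymm hx.2 hx.1
  subst this; ring

theorem Aff.hasSl {θ : ℝ → ℝ} {σ p q x : ℝ} (h : Aff θ σ p q) (hx : x ∈ Ioo p q) :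
    HasSl θ σ x := by
  filter_upwards [isOpen_Ioo.mem_nhds hx] with y hy
  rw [h y (Ioo_subset_Icc_self hy), h x (Ioo_subset_Icc_self hx)]; ring

theorem good_of_reg {T a : ℝ} (hT : 0 < T) (ha : 0 < a) {θ : ℝ → ℝ} (hθ : Continuous θ)
    (h : ∀ x ∈ Ioo 0 T, Reg a θ x) : Good T a θ := by
  obtain ⟨σ, hσ, haff⟩ := affine_of_reg ha hθ h
  refine ⟨T, T, hT.le, le_rfl, le_rfl, σ, σ, σ, mem3 hσ, mem3 hσ, mem3 hσ, haff,
    aff_triv _ _ _, aff_triv _ _ _, ?_⟩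
  rintro ⟨h0, -⟩
  exact absurd h0 (ne0 ha hσ)

theorem good_of_reg3 {T a : ℝ} (ha : 0 < a) {θ : ℝ → ℝ} (hθ : Continuous θ) {s1 s2 : ℝ}
    (h1 : 0 ≤ s1) (h2 : s1 ≤ s2) (h3 : s2 ≤ T)
    (h : ∀ x ∈ Ioo 0 T, x ≠ s1 → x ≠ s2 → Reg a θ x) : Good T a θ := by
  obtain ⟨σ1, hσ1, f1⟩ := affine_of_reg (p := 0) (q := s1) ha hθ (fun x hx =>
    h x ⟨hx.1, by linarith [hx.2]⟩ (by linarith [hx.2] : x < s1).ne (by linarith [hx.2] : x < s2).ne)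
  obtain ⟨σ2, hσ2, f2⟩ := affine_of_reg (p := s1) (q := s2) ha hθ (fun x hx =>
    h x ⟨by linarith [hx.1], by linarith [hx.2]⟩ (ne_of_gt hx.1) (ne_of_lt hx.2))
  obtain ⟨σ3, hσ3, f3⟩ := affine_of_reg (p := s2) (q := T) ha hθ (fun x hx =>
    h x ⟨by linarith [hx.1], by linarith [hx.2]⟩ (by linarith [hx.1] : s1 < x).ne' (ne_of_gt hx.1))
  refine ⟨s1, s2, h1, h2, h3, σ1, σ2, σ3, mem3 hσ1, mem3 hσ2, mem3 hσ3, f1, f2, f3, ?_⟩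
  rintro ⟨h0, -⟩
  exact absurd h0 (ne0 ha hσ1)

theorem const_of_heading {θ : ℝ → ℝ} (hθ : Continuous θ) {p q : ℝ}
    (h : ∀ x ∈ Icc p q, ∃ k : ℤ, θ x = θ p + k * (2 * π)) : Aff θ 0 p q := by
  intro x hx
  obtain ⟨k, hk⟩ := h x hx
  by_cases hk0 : k = 0
  · rw [hk, hk0]; simp
  exfalso
  have hsub := intermediate_value_uIcc (a := p) (b := x) hθ.continuousOn
  have hk1 : (1:ℝ) ≤ |(k:ℝ)| := by exact_mod_cast Int.one_le_abs hk0
  have hπ := pi_pos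
  have fin : ∀ e : ℤ, (e = 1 ∨ e = -1) → θ p + e * π ∉ uIcc (θ p) (θ x) := by
    intro e he hmem
    obtain ⟨w, hw, hwv⟩ := hsub hmem
    rw [uIcc_of_le hx.1] at hw
    obtain ⟨j, hj⟩ := h w ⟨hw.1, hw.2.trans hx.2⟩
    rw [hj] at hwv
    have h2 : (2 * j : ℝ) * π = e * π := by linarith
    have h3 : (2 * j : ℝ) = e := mul_right_cancel₀ hπ.ne' h2
    have h4 : 2 * j = e := by exact_mod_cast h3
    omega
  rcases lt_or_gt_of_ne hk0 with hneg | hpos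
  · have : (k:ℝ) < 0 := by exact_mod_cast hneg
    rw [abs_of_neg this] at hk1
    apply fin (-1) (Or.inr rfl)
    rw [mem_uIcc]; right
    push_cast
    constructor <;> nlinarith
  · have : (0:ℝ) < k := by exact_mod_cast hpos
    rw [abs_of_pos this] at hk1
    apply fin 1 (Or.inl rfl)
    rw [mem_uIcc]; left
    push_cast
    constructor <;> nlinarith

theorem transversal_corner_pos {T a : ℝ} {θ μ : ℝ → ℝ} (hθ : Continuous θ)
    (hpos : ∀ x ∈ Ioo 0 T, 0 < μ x → HasSl θ a x)
    (hneg : ∀ x ∈ Ioo 0 T, μ x < 0 → HasSl θ (-a) x)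
    {x : ℝ} (hx : x ∈ Ioo 0 T) (h0 : μ x = 0) {m : ℝ} (hm : HasDerivAt μ m x) (hm0 : 0 < m) :
    Corner θ (-a) x := by
  have hs := hm.tendsto_slope.eventually (lt_mem_nhds hm0)
  have hs' := eventually_nhdsWithin_iff.1 hs
  obtain ⟨ε, hε, hball⟩ := Metric.eventually_nhds_iff.1 (hs'.and (isOpen_Ioo.mem_nhds hx))
  have hr : ∀ y, x < y → y < x + ε → θ y = θ x + a * (y - x) := by
    intro y h1 h2
    apply affine_of_local hθ (q := y) _ y ⟨h1.le, le_rfl⟩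
    intro w hw
    have hb := hball (y := w) (by rw [Real.dist_eq, abs_of_pos] <;> linarith [hw.1, hw.2])
    apply hpos w hb.2
    have := hb.1 (ne_of_gt hw.1)
    rw [slope_def_field, h0, sub_zero] at this
    exact (div_pos_iff_of_pos_right (sub_pos.2 hw.1)).1 this
  have hlft : ∀ y, x - ε < y → y < x → θ y = θ x + (-a) * (y - x) := by
    intro y h1 h2
    have := affine_of_local hθ (p := y) (q := x) (σ := -a) ?_ x ⟨h2.le, le_rfl⟩
    · linarith
    intro w hw
    have hb := hball (y := w) (by rw [Real.dist_eq, abs_of_neg] <;> linarith [hw.1, hw.2])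
    apply hneg w hb.2
    have := hb.1 (ne_of_lt hw.2)
    rw [slope_def_field, h0, sub_zero] at this
    by_contra hcon
    push Not at hcon
    have := div_nonpos_of_nonneg_of_nonpos hcon (sub_nonpos.2 hw.2.le)
    linarith
  filter_upwards [Ioo_mem_nhds (by linarith : x - ε < x) (by linarith : x < x + ε)] with y hy
  rcases lt_trichotomy x y with h | h | h
  · rw [hr y h hy.2, abs_of_pos (by linarith)]; ring
  · subst h; simp
  · rw [hlft y hy.1 h, abs_of_neg (by linarith)]; ring

theorem transversal_corner_neg {T a : ℝ} {θ μ : ℝ → ℝ} (hθ : Continuous θ)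
    (hpos : ∀ x ∈ Ioo 0 T, 0 < μ x → HasSl θ a x)
    (hneg : ∀ x ∈ Ioo 0 T, μ x < 0 → HasSl θ (-a) x)
    {x : ℝ} (hx : x ∈ Ioo 0 T) (h0 : μ x = 0) {m : ℝ} (hm : HasDerivAt μ m x) (hm0 : m < 0) :
    Corner θ a x := by
  have := transversal_corner_pos (T := T) (a := a) (θ := fun t => - θ t) (μ := fun t => - μ t)
    hθ.neg ?_ ?_ hx (by simp [h0]) hm.neg (by linarith)
  · filter_upwards [this] with y hy
    linarith
  · intro y hy hμ
    filter_upwards [hneg y hy (by linarith)] with w hw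
    linarith
  · intro y hy hμ
    filter_upwards [hpos y hy (by linarith)] with w hw
    linarith

/-- two corners of the same kind with the same heading are impossible -/
theorem no_same_corners {T a : ℝ} (hT : 0 < T) (ha : 0 < a) {θ : ℝ → ℝ} (hm : Mini T a θ)
    {p q s : ℝ} (hp : 0 < p) (hpq : p < q) (hq : q < T) (hs : s = a ∨ s = -a)
    (cp : Corner θ s p) (cq : Corner θ s q) (k : ℤ) (hk : θ q = θ p + k * (2 * π)) : False := by
  have t : Filter.Tendsto (fun δ : ℝ => p - δ) (nhdsWithin 0 (Ioi 0)) (nhdsWithin p (Iio p)) := by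
    apply tendsto_nhdsWithin_of_tendsto_nhds_of_eventually_within
    · have : Continuous (fun y : ℝ => p - y) := by fun_prop
      have := this.tendsto 0
      rw [sub_zero] at this
      exact this.mono_left nhdsWithin_le_nhds
    · filter_upwards [self_mem_nhdsWithin] with δ hδ
      have hδ : 0 < δ := hδ
      show p - δ < p
      linarith
  have t2 : Filter.Tendsto (fun δ : ℝ => q - δ) (nhdsWithin 0 (Ioi 0)) (nhdsWithin q (Iio q)) := by
    apply tendsto_nhdsWithin_of_tendsto_nhds_of_eventually_within
    · have : Continuous (fun y : ℝ => q - y) := by fun_prop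
      have := this.tendsto 0
      rw [sub_zero] at this
      exact this.mono_left nhdsWithin_le_nhds
    · filter_upwards [self_mem_nhdsWithin] with δ hδ
      have hδ : 0 < δ := hδ
      show q - δ < q
      linarith
  have cp' : ∀ᶠ y in nhds p, θ y = θ p - s * |y - p| := cp
  have cq' : ∀ᶠ y in nhds q, θ y = θ q - s * |y - q| := cq
  have ev := (((((t.eventually cp.left).and (t2.eventually cq.left)).and
    ((t.mono_right nhdsWithin_le_nhds).eventually cp')).and
    ((t2.mono_right nhdsWithin_le_nhds).eventually cq')).and
    ((t.mono_right nhdsWithin_le_nhds).eventually (lt_mem_nhds hp))).and self_mem_nhdsWithin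
  obtain ⟨δ, ⟨⟨⟨⟨h1, h2⟩, h3⟩, h4⟩, h5⟩, h6⟩ := ev.exists
  have h6 : 0 < δ := h6
  have := lemY hT ha hm (p := p - δ) (q := q - δ) h5 (by linarith) (by linarith) hs h1 h2 k (by
    rw [h3, h4, hk]
    have e1 : p - δ - p = -δ := by ring
    have e2 : q - δ - q = -δ := by ring
    rw [e1, e2]; ring) p ⟨hp, by linarith⟩
  rcases this with h | h <;> exact cp.not_sl (ne0 ha hs) h

theorem heading_eq2 {x y d : ℝ} (h1 : cos (x - d) = cos (y - d)) (h2 : sin (x - d) = sin (y - d)) :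
    ∃ k : ℤ, x = y + k * (2 * π) := by
  have h4 := sin_sq_add_cos_sq (y - d)
  have h5 : cos (x - y) = 1 := by
    have e : x - y = (x - d) - (y - d) := by ring
    rw [e, cos_sub, h2, h1]
    linarith
  obtain ⟨k, hk⟩ := (cos_eq_one_iff _).1 h5
  exact ⟨k, by linarith⟩

theorem case_small {T a : ℝ} (hT : 0 < T) (ha : 0 < a) {θ μ : ℝ → ℝ} (hm : Mini T a θ)
    (hpos : ∀ x ∈ Ioo 0 T, 0 < μ x → HasSl θ a x)
    (hneg : ∀ x ∈ Ioo 0 T, μ x < 0 → HasSl θ (-a) x) {d h : ℝ}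
    (hd : ∀ x, HasDerivAt μ (sin (θ x - d)) x)
    (hh : ∀ x ∈ Icc 0 T, a * |μ x| = h - cos (θ x - d)) (h1 : -1 < h) (h2 : h < 1) :
    Good T a θ := by
  have hθ := hm.1.continuous
  have hcos : ∀ x ∈ Ioo 0 T, μ x = 0 → cos (θ x - d) = h := by
    intro x hx h0
    have := hh x (Ioo_subset_Icc_self hx)
    rw [h0] at this; simp at this; linarith
  have hsin : ∀ x ∈ Ioo 0 T, μ x = 0 → sin (θ x - d) ^ 2 = 1 - h ^ 2 := by
    intro x hx h0
    have := sin_sq_add_cos_sq (θ x - d)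
    rw [hcos x hx h0] at this; linarith
  have hlt : 0 < 1 - h ^ 2 := by nlinarith
  have uniq : ∀ x ∈ Ioo 0 T, ∀ y ∈ Ioo 0 T, μ x = 0 → μ y = 0 → x < y →
      sin (θ x - d) = sin (θ y - d) → False := by
    intro x hx y hy hx0 hy0 hxy hs
    obtain ⟨k, hk⟩ := heading_eq2 (x := θ y) (y := θ x) (d := d)
      ((hcos y hy hy0).trans (hcos x hx hx0).symm) hs.symm
    have hne : sin (θ x - d) ≠ 0 := by
      intro h0
      have := hsin x hx hx0
      rw [h0] at this; simp at this; linarith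
    rcases lt_or_gt_of_ne hne with hl | hl
    · exact no_same_corners hT ha hm hx.1 hxy hy.2 (Or.inl rfl)
        (transversal_corner_neg hθ hpos hneg hx hx0 (hd x) hl)
        (transversal_corner_neg hθ hpos hneg hy hy0 (hd y) (hs ▸ hl)) k hk
    · exact no_same_corners hT ha hm hx.1 hxy hy.2 (Or.inr rfl)
        (transversal_corner_pos hθ hpos hneg hx hx0 (hd x) hl)
        (transversal_corner_pos hθ hpos hneg hy hy0 (hd y) (hs ▸ hl)) k hk
  have uniq2 : ∀ x ∈ Ioo 0 T, ∀ y ∈ Ioo 0 T, μ x = 0 → μ y = 0 →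
      sin (θ x - d) = sin (θ y - d) → x = y := by
    intro x hx y hy hx0 hy0 hs
    rcases lt_trichotomy x y with h | h | h
    · exact (uniq x hx y hy hx0 hy0 h hs).elim
    · exact h
    · exact (uniq y hy x hx hy0 hx0 h hs.symm).elim
  have one : ∀ r : ℝ, ∃ s ∈ Icc 0 T, ∀ x ∈ Ioo 0 T, μ x = 0 → sin (θ x - d) = r → x = s := by
    intro r
    by_cases hex : ∃ x ∈ Ioo 0 T, μ x = 0 ∧ sin (θ x - d) = r
    · obtain ⟨s, hs, hs0, hsr⟩ := hex
      exact ⟨s, Ioo_subset_Icc_self hs, fun x hx h0 hr =>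
        uniq2 x hx s hs h0 hs0 (hr.trans hsr.symm)⟩
    · push Not at hex
      exact ⟨0, ⟨le_rfl, hT.le⟩, fun x hx h0 hr => absurd hr (hex x hx h0)⟩
  obtain ⟨u, hu, hu2⟩ := one (√(1 - h ^ 2))
  obtain ⟨v, hv, hv2⟩ := one (-√(1 - h ^ 2))
  apply good_of_reg3 ha hθ (s1 := min u v) (s2 := max u v) (le_min hu.1 hv.1)
    (min_le_max) (max_le hu.2 hv.2)
  intro x hx e1 e2
  rcases lt_trichotomy (μ x) 0 with h' | h' | h'
  · exact Or.inr (hneg x hx h')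
  · exfalso
    have hsq : sin (θ x - d) ^ 2 = (√(1 - h ^ 2)) ^ 2 := by
      rw [Real.sq_sqrt hlt.le]; exact hsin x hx h'
    have hxuv : x = u ∨ x = v := by
      rcases sq_eq_sq_iff_eq_or_eq_neg.1 hsq with h3 | h3
      · exact Or.inl (hu2 x hx h' h3)
      · exact Or.inr (hv2 x hx h' h3)
    rcases le_total u v with huv | huv
    · rw [min_eq_left huv] at e1
      rw [max_eq_right huv] at e2
      tauto
    · rw [min_eq_right huv] at e1
      rw [max_eq_left huv] at e2
      tauto
  · exact Or.inl (hpos x hx h')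

/-- the circle case with a gap: `(p,q)` is a full loop with slope `σ`, and there is a regular
point `m` outside with some other heading. -/
theorem gap_case {T a : ℝ} (hT : 0 < T) (ha : 0 < a) {θ : ℝ → ℝ} (hm : Mini T a θ)
    {p q σ m σ' : ℝ} (hp : 0 ≤ p) (hpq : p < q) (hq : q ≤ T) (hσ : σ = a ∨ σ = -a)
    (haff : Aff θ σ p q) (hlen : a * (q - p) = 2 * π) (hmT : m ∈ Ioo 0 T)
    (hmo : m < p ∨ q < m) (hσ' : σ' = a ∨ σ' = -a) (hms : HasSl θ σ' m)
    (hmh : ¬ ∃ k : ℤ, θ m = θ p + k * (2 * π)) : Good T a θ := by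
  have hθ := hm.1.continuous
  have hπ := pi_pos
  -- a point inside the loop with the same heading
  have hin : ∃ w ∈ Ioo p q, ∃ k : ℤ, θ w = θ m + k * (2 * π) := by
    set n := ⌊(θ m - θ p) / (2 * π)⌋ with hn
    have n1 : (n:ℝ) ≤ (θ m - θ p) / (2 * π) := Int.floor_le _
    have n2 : (θ m - θ p) / (2 * π) < n + 1 := Int.lt_floor_add_one _
    rw [le_div_iff₀ (by positivity)] at n1
    rw [div_lt_iff₀ (by positivity)] at n2
    set u := θ m - θ p - n * (2 * π) with hu
    have u0 : 0 < u := by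
      rcases eq_or_lt_of_le (by linarith : 0 ≤ u) with h | h
      · exact absurd ⟨n, by linarith⟩ hmh
      · exact h
    have u1 : u < 2 * π := by linarith
    rcases hσ with hσ | hσ
    · have hmem : p + u / a ∈ Ioo p q := by
        constructor
        · have := div_pos u0 ha; linarith
        · have : u / a < q - p := by rw [div_lt_iff₀ ha]; linarith
          linarith
      refine ⟨p + u / a, hmem, -n, ?_⟩
      rw [haff _ (Ioo_subset_Icc_self hmem), hσ, hu]
      push_cast
      field_simp
      ring
    · have hmem : p + (2 * π - u) / a ∈ Ioo p q := by
        constructor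
        · have := div_pos (sub_pos.2 u1) ha; linarith
        · have : (2 * π - u) / a < q - p := by rw [div_lt_iff₀ ha]; linarith
          linarith
      refine ⟨p + (2 * π - u) / a, hmem, -n - 1, ?_⟩
      rw [haff _ (Ioo_subset_Icc_self hmem), hσ, hu]
      push_cast
      field_simp
      ring
  obtain ⟨w, hw, k, hk⟩ := hin
  have finish : ∀ χ : ℝ → ℝ, Mini T a χ → ∀ v ∈ Ioo p q, HasSl χ σ' v → HasSl χ σ' m →
      (∃ k : ℤ, χ v = χ m + k * (2 * π)) → ∀ τ ∈ Ioo 0 T, Reg a χ τ := by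
    rintro χ hχ v hv s1 s2 ⟨j, hj⟩
    rcases hmo with h | h
    · exact lemY hT ha hχ hmT.1 (by linarith [hv.1] : m < v) (by linarith [hv.2]) hσ' s2 s1 j hj
    · exact lemY hT ha hχ (by linarith [hv.1]) (by linarith [hv.2] : v < m) hmT.2 hσ' s1 s2 (-j)
        (by rw [hj]; push_cast; ring)
  by_cases hs : σ' = σ
  · apply good_of_reg hT ha hθ
    exact finish θ hm w hw (hs ▸ haff.hasSl hw) hms ⟨k, hk⟩
  · have hs' : σ' = -σ := by
      rcases hσ with h | h <;> rcases hσ' with h' | h'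
      · exact absurd (h'.trans h.symm) hs
      · rw [h, h']
      · rw [h, h', neg_neg]
      · exact absurd (h'.trans h.symm) hs
    have hpqk : ∃ c : ℤ, θ q = θ p + c * (2 * π) := by
      have := haff q ⟨hpq.le, le_rfl⟩
      rcases hσ with h | h
      · exact ⟨1, by rw [this, h, hlen]; simp⟩
      · exact ⟨-1, by rw [this, h]; push_cast; linarith⟩
    obtain ⟨c, hc⟩ := hpqk
    have hmr := hm.rev hp hpq.le hq c hc
    set ψ := rev θ p q (c * (2 * π)) with hψ
    have hmid : ∀ x ∈ Icc p q, ψ x = θ (p + q - x) - c * (2 * π) := fun x hx =>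
      rev_mid hc hx.1 hx.2
    have aff2 : Aff ψ (-σ) p q := by
      intro x hx
      rw [hmid x hx, hmid p ⟨le_rfl, hpq.le⟩, haff (p + q - x) ⟨by linarith [hx.2], by linarith [hx.1]⟩]
      have e : p + q - p = q := by ring
      rw [e, haff q ⟨hpq.le, le_rfl⟩]; ring
    have hout : (∃ j : ℤ, ψ m = θ m + j * (2 * π)) ∧ HasSl ψ σ' m := by
      rcases hmo with h | h
      · refine ⟨⟨0, by rw [hψ, rev_le h.le]; simp⟩, ?_⟩
        filter_upwards [show ∀ᶠ y in nhds m, _ = _ from hms, gt_mem_nhds h] with y h1 h2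
        rw [hψ, rev_le h.le, rev_le h2.le]; exact h1
      · refine ⟨⟨-2 * c, by rw [hψ, rev_ge hpq.le hc h.le]; push_cast; ring⟩, ?_⟩
        filter_upwards [show ∀ᶠ y in nhds m, _ = _ from hms, lt_mem_nhds h] with y h1 h2
        rw [hψ, rev_ge hpq.le hc h.le, rev_ge hpq.le hc h2.le, h1]; ring
    obtain ⟨⟨j, hj⟩, hsl⟩ := hout
    have hw' : p + q - w ∈ Ioo p q := ⟨by linarith [hw.2], by linarith [hw.1]⟩
    have hreg := finish ψ hmr (p + q - w) hw' (hs' ▸ aff2.hasSl hw') hsl ⟨k - c - j, by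
      rw [hmid _ (Ioo_subset_Icc_self hw'), hj]
      have e : p + q - (p + q - w) = w := by ring
      rw [e, hk]; push_cast; ring⟩
    obtain ⟨ρ, hρ, hψa⟩ := affine_of_reg ha hmr.1.continuous hreg
    refine ⟨p, q, hp, hpq.le, hq, ρ, σ, ρ, mem3 hρ, mem3 hσ, mem3 hρ, ?_, haff, ?_, ?_⟩
    · intro x hx
      have e1 := hψa x ⟨hx.1, by linarith [hx.2]⟩
      rw [hψ, rev_le hx.2, rev_le hp] at e1
      exact e1
    · intro x hx
      have e1 := hψa x ⟨by linarith [hx.1], hx.2⟩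
      have e2 := hψa q ⟨by linarith, hq⟩
      rw [hψ, rev_ge hpq.le hc hx.1] at e1
      rw [hψ, rev_ge hpq.le hc le_rfl] at e2
      linarith
    · rintro ⟨h0, -⟩
      exact absurd h0 (ne0 ha hρ)

theorem case_one {T a : ℝ} (hT : 0 < T) (ha : 0 < a) {θ μ : ℝ → ℝ} (hm : Mini T a θ)
    (hμc : Continuous μ)
    (hpos : ∀ x ∈ Ioo 0 T, 0 < μ x → HasSl θ a x)
    (hneg : ∀ x ∈ Ioo 0 T, μ x < 0 → HasSl θ (-a) x) {d : ℝ}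
    (hh : ∀ x ∈ Icc 0 T, a * |μ x| = 1 - cos (θ x - d)) :
    Good T a θ := by
  have hθ := hm.1.continuous
  have hπ := pi_pos
  have hreg : ∀ x ∈ Ioo 0 T, μ x ≠ 0 → Reg a θ x := by
    intro x hx h
    rcases lt_or_gt_of_ne h with h | h
    · exact Or.inr (hneg x hx h)
    · exact Or.inl (hpos x hx h)
  have hZ : ∀ x ∈ Icc 0 T, (μ x = 0 ↔ ∃ k : ℤ, θ x = d + k * (2 * π)) := by
    intro x hx
    have e := hh x hx
    constructor
    · intro h0
      rw [h0] at e
      obtain ⟨k, hk⟩ := (cos_eq_one_iff _).1 (by simp at e; linarith : cos (θ x - d) = 1)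
      exact ⟨k, by linarith⟩
    · rintro ⟨k, hk⟩
      have : cos (θ x - d) = 1 := (cos_eq_one_iff _).2 ⟨k, by linarith⟩
      rw [this, sub_self] at e
      rcases mul_eq_zero.1 e with h | h
      · exact absurd h ha.ne'
      · exact abs_eq_zero.1 h
  have hZZ : ∀ x ∈ Icc 0 T, ∀ y ∈ Icc 0 T, μ x = 0 → (μ y = 0 ↔ ∃ k : ℤ, θ y = θ x + k * (2 * π)) := by
    intro x hx y hy h0
    obtain ⟨k, hk⟩ := (hZ x hx).1 h0
    rw [hZ y hy]
    constructor
    · rintro ⟨j, hj⟩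
      exact ⟨j - k, by rw [hj, hk]; push_cast; ring⟩
    · rintro ⟨j, hj⟩
      exact ⟨j + k, by rw [hj, hk]; push_cast; ring⟩
  have hcst : ∀ p q, 0 ≤ p → q ≤ T → (∀ x ∈ Icc p q, μ x = 0) → Aff θ 0 p q := by
    intro p q hp hq hz
    apply const_of_heading hθ
    intro x hx
    have hpq := hx.1.trans hx.2
    exact (hZZ p ⟨hp, hpq.trans hq⟩ x ⟨hp.trans hx.1, hx.2.trans hq⟩
      (hz p ⟨le_rfl, hpq⟩)).1 (hz x hx)
  have hcl : IsClosed {x | μ x = 0} := isClosed_eq hμc continuous_const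
  have hcpt : ∀ p q : ℝ, IsCompact ({x | μ x = 0} ∩ Icc p q) := fun p q =>
    isCompact_Icc.inter_left hcl
  by_cases hgap : ∃ p0 x q0 : ℝ, 0 ≤ p0 ∧ p0 < x ∧ x < q0 ∧ q0 ≤ T ∧ μ p0 = 0 ∧ μ q0 = 0 ∧ μ x ≠ 0
  · obtain ⟨p0, x, q0, hp0, hp0x, hxq0, hq0, hμp0, hμq0, hμx⟩ := hgap
    obtain ⟨p, ⟨hpz, hpI⟩, hpmax⟩ := (hcpt 0 x).exists_isGreatest ⟨p0, hμp0, hp0, hp0x.le⟩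
    obtain ⟨q, ⟨hqz, hqI⟩, hqmin⟩ := (hcpt x T).exists_isLeast ⟨q0, hμq0, hxq0.le, hq0⟩
    have hpz : μ p = 0 := hpz
    have hqz : μ q = 0 := hqz
    have hpx : p < x := lt_of_le_of_ne hpI.2 (by rintro rfl; exact hμx hpz)
    have hxq : x < q := lt_of_le_of_ne hqI.1 (by rintro rfl; exact hμx hqz)
    have hpq := hpx.trans hxq
    have hno : ∀ y ∈ Ioo p q, μ y ≠ 0 := by
      intro y hy h0
      rcases le_total y x with h | h
      · have : y ≤ p := hpmax ⟨h0, by linarith [hpI.1, hy.1], h⟩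
        linarith [hy.1]
      · have : q ≤ y := hqmin ⟨h0, h, by linarith [hqI.2, hy.2]⟩
        linarith [hy.2]
    obtain ⟨σ, hσ, haff⟩ := affine_of_reg ha hθ (fun y hy =>
      hreg y ⟨hpI.1.trans_lt hy.1, hy.2.trans_le hqI.2⟩ (hno y hy))
    have hpT : p ∈ Icc 0 T := ⟨hpI.1, by linarith [hqI.2]⟩
    have hqT : q ∈ Icc 0 T := ⟨by linarith [hpI.1], hqI.2⟩
    have hσabs : |σ| = a := by
      rcases hσ with h | h
      · rw [h, abs_of_pos ha]
      · rw [h, abs_neg, abs_of_pos ha]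
    have hlen : a * (q - p) = 2 * π := by
      obtain ⟨k, hk⟩ := (hZZ p hpT q hqT hpz).1 hqz
      have e1 := haff q ⟨hpq.le, le_rfl⟩
      have e2 : σ * (q - p) = k * (2 * π) := by linarith
      have e3 : a * (q - p) = |(k:ℝ)| * (2 * π) := by
        have := congrArg abs e2
        rwa [abs_mul, abs_mul, hσabs, abs_of_pos (by linarith : 0 < q - p),
          abs_of_pos (by positivity : 0 < 2 * π)] at this
      have hk0 : k ≠ 0 := by
        rintro rfl
        have := mul_pos ha (by linarith : 0 < q - p)
        simp at e3
        rcases e3 with h | h <;> linarith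
      have hk1 : (1:ℝ) ≤ |(k:ℝ)| := by exact_mod_cast Int.one_le_abs hk0
      have hle : 2 * π ≤ a * (q - p) := by rw [e3]; nlinarith
      by_contra hne
      have hlt : 2 * π < a * (q - p) := lt_of_le_of_ne hle (Ne.symm hne)
      have hmem : p + 2 * π / a ∈ Ioo p q := by
        constructor
        · have : 0 < 2 * π / a := by positivity
          linarith
        · have : 2 * π / a < q - p := by rw [div_lt_iff₀ ha]; linarith
          linarith
      apply hno _ hmem
      rw [hZZ p hpT _ ⟨by linarith [hmem.1, hpI.1], by linarith [hmem.2, hqI.2]⟩ hpz,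
        haff _ (Ioo_subset_Icc_self hmem)]
      rcases hσ with h | h
      · refine ⟨1, ?_⟩
        rw [h]; push_cast; field_simp; ring
      · refine ⟨-1, ?_⟩
        rw [h]; push_cast; field_simp; ring
    by_cases hex : ∃ m ∈ Ioo 0 T, (m < p ∨ q < m) ∧ μ m ≠ 0
    · obtain ⟨m, hmT, hmo, hμm⟩ := hex
      have hmh : ¬ ∃ k : ℤ, θ m = θ p + k * (2 * π) := fun h =>
        hμm ((hZZ p hpT m (Ioo_subset_Icc_self hmT) hpz).2 h)
      rcases hreg m hmT hμm with h | h
      · exact gap_case hT ha hm hpI.1 hpq hqI.2 hσ haff hlen hmT hmo (Or.inl rfl) h hmh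
      · exact gap_case hT ha hm hpI.1 hpq hqI.2 hσ haff hlen hmT hmo (Or.inr rfl) h hmh
    · push Not at hex
      have z1 : ∀ y ∈ Icc 0 p, μ y = 0 := by
        intro y hy
        rcases eq_or_lt_of_le hpI.1 with h | h
        · have : y = p := le_antisymm hy.2 (by linarith [hy.1])
          rw [this]; exact hpz
        · rw [← closure_Ioo h.ne] at hy
          exact (closure_minimal (fun w hw => hex w ⟨hw.1, by linarith [hw.2, hpT.2]⟩
            (Or.inl hw.2)) hcl : closure (Ioo 0 p) ⊆ _) hy
      have z2 : ∀ y ∈ Icc q T, μ y = 0 := by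
        intro y hy
        rcases eq_or_lt_of_le hqI.2 with h | h
        · have : y = q := le_antisymm (by linarith [hy.2]) hy.1
          rw [this]; exact hqz
        · rw [← closure_Ioo h.ne] at hy
          exact (closure_minimal (fun w hw => hex w ⟨by linarith [hw.1, hqT.1], hw.2⟩
            (Or.inr hw.1)) hcl : closure (Ioo q T) ⊆ _) hy
      exact ⟨p, q, hpI.1, hpq.le, hqI.2, 0, σ, 0, by simp, mem3 hσ, by simp,
        hcst 0 p le_rfl hpT.2 z1, haff, hcst q T hqT.1 le_rfl z2, fun _ => hlen⟩
  · push Not at hgap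
    by_cases hne : ({x | μ x = 0} ∩ Icc 0 T).Nonempty
    · obtain ⟨p, ⟨hpz, hpI⟩, hpmin⟩ := (hcpt 0 T).exists_isLeast hne
      obtain ⟨q, ⟨hqz, hqI⟩, hqmax⟩ := (hcpt 0 T).exists_isGreatest hne
      have hpz : μ p = 0 := hpz
      have hqz : μ q = 0 := hqz
      have hpq : p ≤ q := hpmin ⟨hqz, hqI⟩
      have zz : ∀ y ∈ Icc p q, μ y = 0 := by
        intro y hy
        rcases eq_or_lt_of_le hy.1 with h | h
        · rw [← h]; exact hpz
        rcases eq_or_lt_of_le hy.2 with h' | h'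
        · rw [h']; exact hqz
        exact hgap p y q hpI.1 h h' hqI.2 hpz hqz
      obtain ⟨σ1, hσ1, f1⟩ := affine_of_reg (p := 0) (q := p) ha hθ (fun x hx =>
        hreg x ⟨hx.1, by linarith [hx.2, hpI.2]⟩ (fun h0 => by
          have : p ≤ x := hpmin ⟨h0, hx.1.le, by linarith [hx.2, hpI.2]⟩
          linarith [hx.2]))
      obtain ⟨σ3, hσ3, f3⟩ := affine_of_reg (p := q) (q := T) ha hθ (fun x hx =>
        hreg x ⟨by linarith [hx.1, hqI.1], hx.2⟩ (fun h0 => by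
          have : x ≤ q := hqmax ⟨h0, by linarith [hx.1, hqI.1], hx.2.le⟩
          linarith [hx.1]))
      refine ⟨p, q, hpI.1, hpq, hqI.2, σ1, 0, σ3, mem3 hσ1, by simp, mem3 hσ3, f1,
        hcst p q hpI.1 hqI.2 zz, f3, ?_⟩
      rintro ⟨h0, -⟩
      exact absurd h0 (ne0 ha hσ1)
    · apply good_of_reg hT ha hθ
      intro x hx
      apply hreg x hx
      intro h0
      exact hne ⟨x, h0, Ioo_subset_Icc_self hx⟩

theorem classify {T a : ℝ} (hT : 0 < T) (ha : 0 < a) {θ : ℝ → ℝ} (hm : Mini T a θ) :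
    Good T a θ := by
  have hθ := hm.1.continuous
  obtain ⟨μ, hμc, hpos, hneg, hz⟩ := structP hT ha hm
  have nz : (∀ x ∈ Icc 0 T, μ x ≠ 0) → Good T a θ := by
    intro hz
    apply good_of_reg hT ha hθ
    intro x hx
    rcases lt_or_gt_of_ne (hz x (Ioo_subset_Icc_self hx)) with h | h
    · exact Or.inr (hneg x hx h)
    · exact Or.inl (hpos x hx h)
  rcases hz with hz | ⟨d, h, hd, hh⟩
  · exact nz hz
  rcases lt_trichotomy h 1 with h1 | h1 | h1
  · rcases le_or_gt h (-1) with h2 | h2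
    · have hc : ∀ x ∈ Icc 0 T, cos (θ x - d) = -1 := by
        intro x hx
        have e := hh x hx
        have := mul_nonneg ha.le (abs_nonneg (μ x))
        have := neg_one_le_cos (θ x - d)
        linarith
      have hA : Aff θ 0 0 T := by
        apply const_of_heading hθ
        intro x hx
        have c0 := hc 0 ⟨le_rfl, hT.le⟩
        refine heading_eq (d := d) ((hc x hx).trans c0.symm) ?_
        have := sin_sq_add_cos_sq (θ 0 - d)
        rw [c0] at this
        exact pow_eq_zero_iff (two_ne_zero) |>.1 (by linarith)
      refine ⟨T, T, hT.le, le_rfl, le_rfl, 0, 0, 0, by simp, by simp, by simp, hA,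
        aff_triv _ _ _, aff_triv _ _ _, ?_⟩
      rintro ⟨-, -, -, h0, -⟩
      exact absurd h0 (lt_irrefl _)
    · exact case_small hT ha hm hpos hneg hd hh h2 h1
  · subst h1
    exact case_one hT ha hm hμc hpos hneg hh
  · apply nz
    intro x hx h0
    have e := hh x hx
    rw [h0] at e
    have := cos_le_one (θ x - d)
    simp at e
    linarith

theorem Lip.mul {a b : ℝ} {f g : ℝ → ℝ} (hf : Lip a f) (hg : Lip b g) (hf1 : ∀ x, |f x| ≤ 1)
    (hg1 : ∀ x, |g x| ≤ 1) : Lip (a + b) (fun t => f t * g t) := by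
  intro x y
  have e : f x * g x - f y * g y = (f x - f y) * g x + f y * (g x - g y) := by ring
  calc |f x * g x - f y * g y| ≤ |(f x - f y) * g x| + |f y * (g x - g y)| := by
        rw [e]; exact abs_add_le _ _
    _ ≤ |f x - f y| * 1 + 1 * |g x - g y| := by
        rw [abs_mul, abs_mul]
        gcongr
        · exact hg1 x
        · exact hf1 y
    _ ≤ (a + b) * |x - y| := by linarith [hf x y, hg x y]

theorem exists_angle {p q : ℝ} (h : p ^ 2 + q ^ 2 = 1) : ∃ c : ℝ, cos c = p ∧ sin c = q := by
  have hn : ‖(⟨p, q⟩ : ℂ)‖ = 1 := by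
    rw [Complex.norm_def, Complex.normSq_mk, ← sq, ← sq, h, Real.sqrt_one]
  have h0 : (⟨p, q⟩ : ℂ) ≠ 0 := by
    intro h'; rw [h'] at hn; simp at hn
  refine ⟨Complex.arg ⟨p, q⟩, ?_, ?_⟩
  · rw [Complex.cos_arg h0, hn]; simp
  · rw [Complex.sin_arg, hn]; simp

theorem angle_lift {T a : ℝ} (hT : 0 ≤ T) {p q : ℝ → ℝ} (hp : Lip a p) (hq : Lip a q)
    (hpq : ∀ x y, (p x - p y) ^ 2 + (q x - q y) ^ 2 ≤ (a * |x - y|) ^ 2)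
    (h1 : ∀ x, p x ^ 2 + q x ^ 2 = 1) :
    ∃ θ : ℝ → ℝ, Lip a θ ∧ ∀ x ∈ Icc 0 T, p x = cos (θ x) ∧ q x = sin (θ x) := by
  have ha : 0 ≤ a := hp.nonneg
  obtain ⟨c, hc1, hc2⟩ := exists_angle (h1 0)
  set g : ℝ → ℝ := fun t => p t * deriv q t - q t * deriv p t with hg
  set f : ℝ → ℝ := fun t => max (-a) (min a (g t)) with hf
  have hgm : Measurable g :=
    (hp.continuous.measurable.mul (measurable_deriv q)).sub
      (hq.continuous.measurable.mul (measurable_deriv p))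
  have hfm : Measurable f := measurable_const.max (measurable_const.min hgm)
  have hfb : ∀ t, ‖f t‖ ≤ a := by
    intro t
    rw [Real.norm_eq_abs, abs_le]
    exact ⟨le_max_left _ _, max_le (by linarith) (min_le_left _ _)⟩
  have hfl : LocallyIntegrable f volume := by
    refine LocallyIntegrable.mono (locallyIntegrable_const a) hfm.aestronglyMeasurable ?_
    filter_upwards with t
    exact (hfb t).trans (le_abs_self a)
  have hfi : ∀ x y : ℝ, IntervalIntegrable f volume x y := fun x y =>
    intervalIntegrable_iff.mpr
      ((hfl.integrableOn_isCompact isCompact_uIcc).mono_set uIoc_subset_uIcc)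
  set θ : ℝ → ℝ := fun x => c + ∫ t in (0:ℝ)..x, f t with hθ
  have hθl : Lip a θ := by
    intro x y
    have e : θ x - θ y = ∫ t in y..x, f t := by
      simp only [hθ]
      rw [← intervalIntegral.integral_interval_sub_left (hfi 0 x) (hfi 0 y)]; ring
    rw [e]
    exact intervalIntegral.norm_integral_le_of_norm_le_const (fun t _ => hfb t)
  have key : ∀ᵐ x, ∃ p' q' : ℝ, HasDerivAt p p' x ∧ HasDerivAt q q' x ∧
      HasDerivAt θ (p x * q' - q x * p') x ∧ p x * p' + q x * q' = 0 := by
    filter_upwards [hp.lipschitzWith.ae_differentiableAt_real,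
      hq.lipschitzWith.ae_differentiableAt_real, LocallyIntegrable.ae_hasDerivAt_integral hfl] with x hpx hqx hfx
    refine ⟨deriv p x, deriv q x, hpx.hasDerivAt, hqx.hasDerivAt, ?_, ?_⟩
    · have hF : HasDerivAt (fun y => p x * q y - q x * p y) (g x) x :=
        (hqx.hasDerivAt.const_mul _).sub (hpx.hasDerivAt.const_mul _)
      have hb : ‖g x‖ ≤ a := by
        refine hF.le_of_lip' ha (Filter.Eventually.of_forall fun y => ?_)
        rw [Real.norm_eq_abs, Real.norm_eq_abs]
        refine abs_le_of_sq_le_sq ?_ (by positivity)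
        refine le_trans ?_ (hpq y x)
        have h1x := h1 x
        have e : (p x * q y - q x * p y - (p x * q x - q x * p x)) =
          p x * (q y - q x) - q x * (p y - p x) := by ring
        rw [e]
        set u := p y - p x
        set v := q y - q x
        have : (p x ^ 2 + q x ^ 2) * (u ^ 2 + v ^ 2) = u ^ 2 + v ^ 2 := by rw [h1x, one_mul]
        nlinarith [sq_nonneg (p x * u + q x * v)]
      have hfg : f x = g x := by
        rw [Real.norm_eq_abs, abs_le] at hb
        simp only [hf]
        rw [min_eq_right hb.2, max_eq_right hb.1]
      have := (hfx 0).const_add c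
      rw [hfg] at this
      exact this
    · have h2 : HasDerivAt (fun y => p y * p y + q y * q y)
          (deriv p x * p x + p x * deriv p x + (deriv q x * q x + q x * deriv q x)) x :=
        (hpx.hasDerivAt.mul hpx.hasDerivAt).add (hqx.hasDerivAt.mul hqx.hasDerivAt)
      have h3 : (fun y => p y * p y + q y * q y) = fun _ => (1:ℝ) := by
        funext y; rw [← h1 y]; ring
      rw [h3] at h2
      have := h2.unique (hasDerivAt_const x (1:ℝ))
      linarith
  have hp1 : ∀ x, |p x| ≤ 1 := fun x => by
    rw [← abs_one]; apply sq_le_sq.mp; nlinarith [h1 x, sq_nonneg (q x)]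
  have hq1 : ∀ x, |q x| ≤ 1 := fun x => by
    rw [← abs_one]; apply sq_le_sq.mp; nlinarith [h1 x, sq_nonneg (p x)]
  have hθ0 : θ 0 = c := by simp [hθ]
  have H1 := const_of_ae ((hp.mul hθl.cos hp1 (fun x => abs_cos_le_one _)).add
    (hq.mul hθl.sin hq1 (fun x => abs_sin_le_one _))) T hT (by
      filter_upwards [key] with x ⟨p', q', d1, d2, d3, d4⟩ _
      refine HasDerivAt.congr_deriv ((d1.mul d3.cos).add (d2.mul d3.sin)) ?_
      have h1x := h1 x
      have e1 : p' + q x * (p x * q' - q x * p') = 0 := by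
        linear_combination (-p') * h1x + p x * d4
      have e2 : q' - p x * (p x * q' - q x * p') = 0 := by
        linear_combination (-q') * h1x + q x * d4
      linear_combination cos (θ x) * e1 + sin (θ x) * e2)
  have H2 := const_of_ae ((hq.mul hθl.cos hq1 (fun x => abs_cos_le_one _)).add
    ((hp.mul hθl.sin hp1 (fun x => abs_sin_le_one _)).const_mul (-1))) T hT (by
      filter_upwards [key] with x ⟨p', q', d1, d2, d3, d4⟩ _
      refine HasDerivAt.congr_deriv ((d2.mul d3.cos).add ((d1.mul d3.sin).const_mul (-1))) ?_
      have h1x := h1 x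
      have e1 : p' + q x * (p x * q' - q x * p') = 0 := by
        linear_combination (-p') * h1x + p x * d4
      have e2 : q' - p x * (p x * q' - q x * p') = 0 := by
        linear_combination (-q') * h1x + q x * d4
      linear_combination cos (θ x) * e2 - sin (θ x) * e1)
  refine ⟨θ, hθl, fun x hx => ?_⟩
  have a1 := H1 x hx
  have a2 := H2 x hx
  simp only [hθ0, hc1, hc2] at a1 a2
  have hz := h1 0
  have hcs := sin_sq_add_cos_sq (θ x)
  have a1' : p x * cos (θ x) + q x * sin (θ x) = 1 := by linarith
  have a2' : q x * cos (θ x) - p x * sin (θ x) = 0 := by linarith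
  constructor
  · linear_combination cos (θ x) * a1' - sin (θ x) * a2' - p x * hcs
  · linear_combination sin (θ x) * a1' + cos (θ x) * a2' - q x * hcs


@[simp] theorem pt_zero (x y : ℝ) : pt x y 0 = x := rfl
@[simp] theorem pt_one (x y : ℝ) : pt x y 1 = y := rfl

theorem pt_ext {u v : Pt} (h0 : u 0 = v 0) (h1 : u 1 = v 1) : u = v := by
  ext i; fin_cases i
  · exact h0
  · exact h1

theorem norm_sq_pt (v : Pt) : ‖v‖ ^ 2 = v 0 ^ 2 + v 1 ^ 2 := by
  rw [EuclideanSpace.norm_sq_eq, Fin.sum_univ_two]; simp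

theorem pt_eq (x y : ℝ) : pt x y = x • pt 1 0 + y • pt 0 1 := by
  apply pt_ext <;> simp

theorem hasDerivAt_pt {f g : ℝ → ℝ} {f' g' t : ℝ} (hf : HasDerivAt f f' t)
    (hg : HasDerivAt g g' t) : HasDerivAt (fun s => pt (f s) (g s)) (pt f' g') t := by
  have h := (hf.smul_const (pt 1 0)).add (hg.smul_const (pt 0 1))
  rw [pt_eq f' g']
  refine h.congr_of_eventuallyEq (Filter.Eventually.of_forall fun s => ?_)
  exact pt_eq _ _

theorem coord_hasDerivAt {z : ℝ → Pt} {v : Pt} {t : ℝ} (h : HasDerivAt z v t) (i : Fin 2) :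
    HasDerivAt (fun s => z s i) (v i) t :=
  (EuclideanSpace.proj (𝕜 := ℝ) i).hasFDerivAt.comp_hasDerivAt t h

theorem cs_dist (α β : ℝ) : ‖pt (cos α) (sin α) - pt (cos β) (sin β)‖ ≤ |α - β| := by
  refine abs_le_of_sq_le_sq' ?_ (abs_nonneg _) |>.2
  rw [norm_sq_pt, sq_abs]
  simp only [PiLp.sub_apply, pt_zero, pt_one]
  have h := one_sub_sq_div_two_le_cos (x := α - β)
  rw [cos_sub] at h
  nlinarith [sin_sq_add_cos_sq α, sin_sq_add_cos_sq β]

theorem cs_norm (α : ℝ) : ‖pt (cos α) (sin α)‖ = 1 := by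
  have h := norm_sq_pt (pt (cos α) (sin α))
  simp only [pt_zero, pt_one, cos_sq_add_sin_sq] at h
  nlinarith [norm_nonneg (pt (cos α) (sin α))]

theorem coord_int {T : ℝ} (hT : 0 ≤ T) {z z' : ℝ → Pt}
    (h : ∀ t ∈ Icc 0 T, HasDerivWithinAt z (z' t) (Icc 0 T) t) (i : Fin 2) {φ : ℝ → ℝ}
    (hφ : Continuous φ) (he : ∀ t ∈ Icc 0 T, z' t i = φ t) :
    ∫ t in (0:ℝ)..T, φ t = z T i - z 0 i := by
  apply intervalIntegral.integral_eq_sub_of_hasDerivAt_of_le hT (f := fun t => z t i)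
  · intro t ht
    exact (EuclideanSpace.proj (𝕜 := ℝ) i).continuous.continuousAt.comp_continuousWithinAt
      (h t ht).continuousWithinAt
  · intro t ht
    have h1 := (h t (Ioo_subset_Icc_self ht)).hasDerivAt (Icc_mem_nhds ht.1 ht.2)
    rw [← he t (Ioo_subset_Icc_self ht)]
    exact coord_hasDerivAt h1 i
  · exact hφ.intervalIntegrable _ _

theorem lip_of_maxCurv {s : Set ℝ} {z' : ℝ → Pt} (hK : ∃ K : NNReal, LipschitzOnWith K z' s)
    {x y : ℝ} (hx : x ∈ s) (hy : y ∈ s) : ‖z' x - z' y‖ ≤ maxCurvOn s z' * |x - y| := by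
  by_cases hxy : x = y
  · simp [hxy]
  have hpos : 0 < |x - y| := abs_pos.mpr (sub_ne_zero.mpr hxy)
  rw [← div_le_iff₀ hpos]
  obtain ⟨K, hK⟩ := hK
  refine le_csInf ⟨K, K.2, by simpa using hK⟩ ?_
  rintro c ⟨hc, hl⟩
  rw [div_le_iff₀ hpos]
  have := hl.dist_le_mul x hx y hy
  rwa [dist_eq_norm, Real.dist_eq, Real.coe_toNNReal c hc] at this

theorem mini_of_min {z0 v0 zf vf : Pt} {tf a : ℝ} (htf : 0 < tf) {z z' : ℝ → Pt}
    (hadm : AdmissibleOn 0 tf z0 v0 zf vf z z')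
    (hcurv : maxCurvOn (Icc 0 tf) z' = a)
    (hmin : ∀ w w' : ℝ → Pt, AdmissibleOn 0 tf z0 v0 zf vf w w' →
      maxCurvOn (Icc 0 tf) z' ≤ maxCurvOn (Icc 0 tf) w') {θ : ℝ → ℝ} (hθ : Lip a θ)
    (he : ∀ t ∈ Icc 0 tf, z' t = pt (cos (θ t)) (sin (θ t))) : Mini tf a θ := by
  obtain ⟨hder, -, -, hz0, hzf, hv0, hvf⟩ := hadm
  refine ⟨hθ, fun b hb ψ hψ h0 hT hc hs => ?_⟩
  have h0m : (0:ℝ) ∈ Icc 0 tf := ⟨le_rfl, htf.le⟩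
  have hTm : tf ∈ Icc 0 tf := ⟨htf.le, le_rfl⟩
  have hψc := hψ.continuous
  have hθc := hθ.continuous
  have hcc : Continuous fun t => cos (ψ t) := continuous_cos.comp hψc
  have hsc : Continuous fun t => sin (ψ t) := continuous_sin.comp hψc
  have i0 := coord_int htf.le hder 0 (continuous_cos.comp hθc) (fun t ht => by rw [he t ht]; rfl)
  have i1 := coord_int htf.le hder 1 (continuous_sin.comp hθc) (fun t ht => by rw [he t ht]; rfl)
  simp only [Function.comp_apply] at i0 i1
  have hL : LipschitzOnWith (Real.toNNReal b) (fun t => pt (cos (ψ t)) (sin (ψ t))) (Icc 0 tf) := by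
    apply LipschitzOnWith.of_dist_le_mul
    intro x _ y _
    rw [dist_eq_norm, Real.dist_eq, Real.coe_toNNReal b hψ.nonneg]
    exact (cs_dist _ _).trans (hψ x y)
  have hw := hmin (fun t => z0 + pt (∫ s in (0:ℝ)..t, cos (ψ s)) (∫ s in (0:ℝ)..t, sin (ψ s)))
    (fun t => pt (cos (ψ t)) (sin (ψ t))) ⟨?_, ⟨_, hL⟩, fun t _ => cs_norm _, ?_, ?_, ?_, ?_⟩
  · have : maxCurvOn (Icc 0 tf) (fun t => pt (cos (ψ t)) (sin (ψ t))) ≤ b :=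
      csInf_le ⟨0, fun c hc => hc.1⟩ ⟨hψ.nonneg, hL⟩
    linarith
  · intro t _
    exact ((hasDerivAt_pt (hcc.integral_hasStrictDerivAt 0 t).hasDerivAt
      (hsc.integral_hasStrictDerivAt 0 t).hasDerivAt).const_add z0).hasDerivWithinAt
  · apply pt_ext <;> simp
  · apply pt_ext
    · simp only [PiLp.add_apply, pt_zero]
      rw [hc, i0, hz0, hzf]; ring
    · simp only [PiLp.add_apply, pt_one]
      rw [hs, i1, hz0, hzf]; ring
  · simp only [h0]
    rw [← hv0, he 0 h0m]
  · obtain ⟨k, hk⟩ := hT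
    simp only [hk]
    rw [← hvf, he tf hTm, cos_add_int_mul_two_pi, sin_add_int_mul_two_pi]

theorem arc_of_aff {tf ω p q : ℝ} {z' : ℝ → Pt} {θ : ℝ → ℝ} (hp : 0 ≤ p) (hq : q ≤ tf)
    (he : ∀ t ∈ Icc 0 tf, z' t = pt (cos (θ t)) (sin (θ t))) (h : Aff θ ω p q) :
    ∀ᵐ t ∂volume, t ∈ Ioo p q → HasDerivAt z' (ω • J (z' t)) t := by
  filter_upwards with t ht
  have hd := (h.hasSl ht).hasDerivAt
  have hm : ∀ s ∈ Ioo p q, s ∈ Icc 0 tf := fun s hs =>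
    ⟨hp.trans hs.1.le, hs.2.le.trans hq⟩
  have hev : z' =ᶠ[nhds t] fun s => pt (cos (θ s)) (sin (θ s)) := by
    filter_upwards [isOpen_Ioo.mem_nhds ht] with s hs
    exact he s (hm s hs)
  refine HasDerivAt.congr_deriv ((hasDerivAt_pt hd.cos hd.sin).congr_of_eventuallyEq hev) ?_
  rw [he t (hm t ht)]
  apply pt_ext <;> simp [J] <;> ring

theorem lift_of_adm {tf a : ℝ} (htf : 0 ≤ tf) {z' : ℝ → Pt}
    (hl : ∀ x ∈ Icc 0 tf, ∀ y ∈ Icc 0 tf, ‖z' x - z' y‖ ≤ a * |x - y|) (ha : 0 ≤ a)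
    (hu : ∀ t ∈ Icc 0 tf, ‖z' t‖ = 1) :
    ∃ θ : ℝ → ℝ, Lip a θ ∧ ∀ t ∈ Icc 0 tf, z' t = pt (cos (θ t)) (sin (θ t)) := by
  set κ : ℝ → ℝ := fun t => (projIcc 0 tf htf t : ℝ) with hκ
  have hκm : ∀ t, κ t ∈ Icc 0 tf := fun t => (projIcc 0 tf htf t).2
  have hκl : ∀ x y, |κ x - κ y| ≤ |x - y| := fun x y => by
    have := (LipschitzWith.projIcc htf).dist_le_mul x y
    rw [NNReal.coe_one, one_mul, Real.dist_eq] at this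
    exact this
  have hκe : ∀ t ∈ Icc 0 tf, κ t = t := fun t ht => by
    simp only [hκ]; rw [projIcc_of_mem htf ht]
  have hd : ∀ x y, ‖z' (κ x) - z' (κ y)‖ ≤ a * |x - y| := fun x y =>
    (hl _ (hκm x) _ (hκm y)).trans (mul_le_mul_of_nonneg_left (hκl x y) ha)
  have hpq : ∀ x y, (z' (κ x) 0 - z' (κ y) 0) ^ 2 + (z' (κ x) 1 - z' (κ y) 1) ^ 2
      ≤ (a * |x - y|) ^ 2 := fun x y => by
    have := norm_sq_pt (z' (κ x) - z' (κ y))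
    simp only [PiLp.sub_apply] at this
    rw [← this]
    exact pow_le_pow_left₀ (norm_nonneg _) (hd x y) 2
  obtain ⟨θ, h1, h2⟩ := angle_lift (T := tf) (a := a) htf (p := fun t => z' (κ t) 0)
    (q := fun t => z' (κ t) 1)
    (fun x y => abs_le_of_sq_le_sq
      (by nlinarith [hpq x y, sq_nonneg (z' (κ x) 1 - z' (κ y) 1)]) (by positivity))
    (fun x y => abs_le_of_sq_le_sq
      (by nlinarith [hpq x y, sq_nonneg (z' (κ x) 0 - z' (κ y) 0)]) (by positivity))
    hpq (fun x => by rw [← norm_sq_pt, hu _ (hκm x), one_pow])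
  refine ⟨θ, h1, fun t ht => ?_⟩
  have := h2 t ht
  simp only [hκe t ht] at this
  exact pt_ext this.1 this.2

/-- Theorem 3 of the paper: classification of curves of minimax
curvature. Any minimiser `z` of Problem (P), with maximum curvature `a`, is a
concatenation of at most three pieces along a partition `0 ≤ s1 ≤ s2 ≤ tf`, each piece a
line segment (`ωᵢ = 0`) or a circular arc of signed curvature `ωᵢ = ±a`; moreover the
partition can be chosen so that in the case of type `SOS` (both outer pieces are
nondegenerate lines and the middle piece is an arc) the middle arc is a full circle:
`a (s2 − s1) = 2π`. -/
theorem stmt10 (z0 v0 zf vf : Pt) (tf a : ℝ) (htf : 0 < tf)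
    (z z' : ℝ → Pt)
    (hadm : AdmissibleOn 0 tf z0 v0 zf vf z z')
    (hcurv : maxCurvOn (Icc 0 tf) z' = a)
    (hmin : ∀ w w' : ℝ → Pt, AdmissibleOn 0 tf z0 v0 zf vf w w' →
      maxCurvOn (Icc 0 tf) z' ≤ maxCurvOn (Icc 0 tf) w') :
    ∃ s1 s2 : ℝ, 0 ≤ s1 ∧ s1 ≤ s2 ∧ s2 ≤ tf ∧
      ∃ ω1 ω2 ω3 : ℝ,
        ω1 ∈ ({-a, 0, a} : Set ℝ) ∧ ω2 ∈ ({-a, 0, a} : Set ℝ) ∧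
        ω3 ∈ ({-a, 0, a} : Set ℝ) ∧
        (∀ᵐ t ∂volume, t ∈ Ioo (0:ℝ) s1 → HasDerivAt z' (ω1 • J (z' t)) t) ∧
        (∀ᵐ t ∂volume, t ∈ Ioo s1 s2 → HasDerivAt z' (ω2 • J (z' t)) t) ∧
        (∀ᵐ t ∂volume, t ∈ Ioo s2 tf → HasDerivAt z' (ω3 • J (z' t)) t) ∧
        ((ω1 = 0 ∧ ω3 = 0 ∧ 0 < s1 ∧ s2 < tf ∧ ω2 ≠ 0) → a * (s2 - s1) = 2 * π) := by
  have hadm2 := hadm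
  obtain ⟨-, hK, hu, -⟩ := hadm2
  have hl : ∀ x ∈ Icc 0 tf, ∀ y ∈ Icc 0 tf, ‖z' x - z' y‖ ≤ a * |x - y| := fun x hx y hy => by
    rw [← hcurv]; exact lip_of_maxCurv hK hx hy
  have ha0 : 0 ≤ a := by
    rw [← hcurv]; exact Real.sInf_nonneg fun c hc => hc.1
  obtain ⟨θ, hθ, he⟩ := lift_of_adm htf.le hl ha0 hu
  have hgood : Good tf a θ := by
    rcases ha0.eq_or_lt with h | ha
    · refine ⟨tf, tf, htf.le, le_rfl, le_rfl, 0, 0, 0, by simp, by simp, by simp, ?_,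
        aff_triv _ _ _, aff_triv _ _ _, fun h => absurd h.2.2.2.1 (lt_irrefl _)⟩
      intro x _
      have := hθ x 0
      rw [← h, zero_mul] at this
      have := abs_nonpos_iff.mp this
      linarith
    · exact classify htf ha (mini_of_min htf hadm hcurv hmin hθ he)
  obtain ⟨s1, s2, h1, h2, h3, ω1, ω2, ω3, m1, m2, m3, f1, f2, f3, hS⟩ := hgood
  exact ⟨s1, s2, h1, h2, h3, ω1, ω2, ω3, m1, m2, m3,
    arc_of_aff le_rfl (h2.trans h3) he f1, arc_of_aff h1 h3 he f2,
    arc_of_aff (h1.trans h2) le_rfl he f3, hS⟩
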